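/- arXiv:2405.05415 — 4 statements merged into one kernel-verified Lean document; each statement's English description precedes it below -/
import Mathlib

section
/- Let φ₁ : [0,2] → ℝ be convex, φ₂ : [0,2] → ℝ be concave, with φ₁ ≤ φ₂, φ₁(0) = φ₂(0) = φ₁(2) = φ₂(2) = 0, and let Ω = {(x,y) : 0 ≤ x ≤ 2, φ₁(x) ≤ y ≤ φ₂(x)} have nonempty interior. Set m = max(|φ₁′(0⁺)|, |φ₂′(0⁺)|), where φᵢ′(0⁺) denotes the one-sided derivative at 0 (assumed finite). Then for every continuous concave function u : Ω → ℝ, differentiable almost everywhere with bounded gradient and vanishing on ∂Ω, the integrals over the left half I_x = ∫₀¹ ∫_{φ₁(x)}^{φ₂(x)} u_x² dy dx and I_y = ∫₀¹ ∫_{φ₁(x)}^{φ₂(x)} u_y² dy dx satisfy I_x ≤ 2 m² (1 + 4/π²) · I_y. -/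
open MeasureTheory Real Set Filter Asymptotics

/-- The partial derivative `u_x` (defined via the full derivative; `0` where `u` is
not differentiable). -/
noncomputable def uX (u : ℝ × ℝ → ℝ) (p : ℝ × ℝ) : ℝ := fderiv ℝ u p (1, 0)

/-- The partial derivative `u_y`. -/
noncomputable def uY (u : ℝ × ℝ → ℝ) (p : ℝ × ℝ) : ℝ := fderiv ℝ u p (0, 1)

/-- Membership in the class `U_Ω`: continuous concave functions on `Ω`, differentiable
almost everywhere, with bounded gradient, vanishing on `∂Ω`. -/
def MemU (Ω : Set (ℝ × ℝ)) (u : ℝ × ℝ → ℝ) : Prop :=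
  ContinuousOn u (closure Ω) ∧ ConcaveOn ℝ Ω u ∧
    (∀ᵐ p ∂(volume.restrict Ω), DifferentiableAt ℝ u p) ∧
    (∃ C : ℝ, ∀ p ∈ Ω, DifferentiableAt ℝ u p → ‖fderiv ℝ u p‖ ≤ C) ∧
    (∀ p ∈ frontier Ω, u p = 0)

/-- `∫_Ω u_x² dx dy`. -/
noncomputable def Ix (Ω : Set (ℝ × ℝ)) (u : ℝ × ℝ → ℝ) : ℝ := ∫ p in Ω, (uX u p) ^ 2

/-- `∫_Ω u_y² dx dy`. -/
noncomputable def Iy (Ω : Set (ℝ × ℝ)) (u : ℝ × ℝ → ℝ) : ℝ := ∫ p in Ω, (uY u p) ^ 2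

/-- The abscissa of the left vertical support line of `Ω`. -/
noncomputable def leftX (Ω : Set (ℝ × ℝ)) : ℝ := sInf (Prod.fst '' Ω)

/-- The abscissa of the right vertical support line of `Ω`. -/
noncomputable def rightX (Ω : Set (ℝ × ℝ)) : ℝ := sSup (Prod.fst '' Ω)

/-- The vertical support line `{x = x₀}` of `Ω`, touching `Ω` at the contact point
`(x₀, p₂)`, is angular: every `(x,y) ∈ Ω` satisfies `|y - p₂| ≤ C|x - x₀|`. -/
def AngularSupportAt (Ω : Set (ℝ × ℝ)) (x₀ : ℝ) : Prop :=
  ∃ p₂ : ℝ, (x₀, p₂) ∈ closure Ω ∧ ∃ C > 0, ∀ q ∈ Ω, |q.2 - p₂| ≤ C * |q.1 - x₀|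

/-- The `C¹` norm `sup |u| + sup |u_x| + sup |u_y|`, the suprema over the derivatives
being taken over the points where they exist. -/
noncomputable def C1Norm (Ω : Set (ℝ × ℝ)) (u : ℝ × ℝ → ℝ) : ℝ :=
  sSup ((fun p => |u p|) '' Ω) +
    sSup ((fun p => |uX u p|) '' {p ∈ Ω | DifferentiableAt ℝ u p}) +
    sSup ((fun p => |uY u p|) '' {p ∈ Ω | DifferentiableAt ℝ u p})

/-- The resistance functional `F(u) = ∫_Ω f(∇u) dx dy`. -/
noncomputable def Fres (Ω : Set (ℝ × ℝ)) (f : ℝ × ℝ → ℝ) (u : ℝ × ℝ → ℝ) : ℝ :=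
  ∫ p in Ω, f (uX u p, uY u p)

/-- The zero function is a local minimum of `F` on `U_Ω` in the `C¹` norm. -/
def ZeroIsLocalMin (Ω : Set (ℝ × ℝ)) (f : ℝ × ℝ → ℝ) : Prop :=
  ∃ δ : ℝ, 0 < δ ∧ ∀ u : ℝ × ℝ → ℝ, MemU Ω u → C1Norm Ω u < δ →
    Fres Ω f (fun _ => 0) ≤ Fres Ω f u

/-- `n` is an outward normal of a support line to `Ω` at `ξ`. -/
def IsSupportDir (Ω : Set (ℝ × ℝ)) (ξ n : ℝ × ℝ) : Prop :=
  n ≠ 0 ∧ ∀ q ∈ Ω, n.1 * q.1 + n.2 * q.2 ≤ n.1 * ξ.1 + n.2 * ξ.2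

/-- `ξ` is a regular boundary point: the support line at `ξ` is unique. -/
def IsRegularPoint (Ω : Set (ℝ × ℝ)) (ξ : ℝ × ℝ) : Prop :=
  ξ ∈ frontier Ω ∧
    ∀ n m : ℝ × ℝ, IsSupportDir Ω ξ n → IsSupportDir Ω ξ m → ∃ t : ℝ, m = t • n

/-- `ξ` is a singular boundary point: `Ω` has more than one support line at `ξ`. -/
def IsSingularPoint (Ω : Set (ℝ × ℝ)) (ξ : ℝ × ℝ) : Prop :=
  ξ ∈ frontier Ω ∧
    ∃ n m : ℝ × ℝ, IsSupportDir Ω ξ n ∧ IsSupportDir Ω ξ m ∧ ¬∃ t : ℝ, m = t • n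

open Topology

/-- Weighted form of Wirtinger's inequality for a concave function vanishing at the endpoints. -/
lemma ConcaveOn.mul_integral_sq_le_integral_deriv_sq {f v : ℝ → ℝ} {a b k : ℝ} (hab : a ≤ b)
    (hc : ContinuousOn f (Icc a b)) (hf : ConcaveOn ℝ (Icc a b) f) (ha : f a = 0) (hb : f b = 0)
    (hv : ∀ᵐ y, y ∈ Icc a b → HasDerivAt f (v y) y)
    (hint : IntegrableOn (fun y => v y ^ 2) (Icc a b)) (hk : 0 ≤ k) (hkπ : k * (b - a) < π) :
    k ^ 2 * ∫ y in a..b, f y ^ 2 ≤ ∫ y in a..b, v y ^ 2 := by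
  set r : ℝ → ℝ := fun y => derivWithin f (Ioi y) y with hr
  have hrv : ∀ᵐ y, y ∈ Icc a b → v y ^ 2 = r y ^ 2 := by
    filter_upwards [hv] with y hy hyI
    rw [hr]
    simp only
    rw [(hy hyI).hasDerivWithinAt.derivWithin (uniqueDiffWithinAt_Ioi y)]
  have hrint : IntegrableOn (fun y => r y ^ 2) (Icc a b) :=
    hint.congr_fun_ae ((ae_restrict_iff' measurableSet_Icc).2 hrv)
  have hfint : IntegrableOn (fun y => f y ^ 2) (Icc a b) := (hc.pow 2).integrableOn_Icc
  set θ : ℝ → ℝ := fun y => k * (y - (a + b) / 2) with hθ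
  have hcos : ∀ y ∈ Icc a b, 0 < cos (θ y) := by
    intro y hy
    refine cos_pos_of_mem_Ioo ⟨?_, ?_⟩ <;> simp only [hθ] <;>
      nlinarith [mul_nonneg hk (sub_nonneg.2 hy.1), mul_nonneg hk (sub_nonneg.2 hy.2)]
  have hθd : ∀ y, HasDerivAt θ k y := fun y => by
    simpa using ((hasDerivAt_id y).sub_const ((a + b) / 2)).const_mul k
  have htan : ∀ y ∈ Icc a b,
      HasDerivAt (fun y => tan (θ y)) (1 / cos (θ y) ^ 2 * k) y := fun y hy =>
    (hasDerivAt_tan (hcos y hy).ne').comp y (hθd y)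
  have key := intervalIntegral.sub_le_integral_of_hasDeriv_right_of_le
    (g := fun y => -(k * (tan (θ y) * f y ^ 2)))
    (g' := fun y => -(k * (1 / cos (θ y) ^ 2 * k * f y ^ 2 + tan (θ y) * (2 * f y * r y))))
    (φ := fun y => r y ^ 2 - k ^ 2 * f y ^ 2) hab ?_ ?_ ?_ ?_
  · have h1 : ∫ y in a..b, (r y ^ 2 - k ^ 2 * f y ^ 2) =
        (∫ y in a..b, v y ^ 2) - k ^ 2 * ∫ y in a..b, f y ^ 2 := by
      rw [intervalIntegral.integral_sub, intervalIntegral.integral_const_mul]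
      · congr 1
        refine intervalIntegral.integral_congr_ae ?_
        filter_upwards [hrv] with y hy hyI
        rw [uIoc_of_le hab] at hyI
        exact (hy (Ioc_subset_Icc_self hyI)).symm
      · exact (intervalIntegrable_iff_integrableOn_Icc_of_le hab).2 hrint
      · exact (intervalIntegrable_iff_integrableOn_Icc_of_le hab).2 (hfint.const_mul _)
    rw [h1, ha, hb] at key
    simp at key
    exact key
  · refine ((ContinuousOn.mul (fun y hy => ?_) (hc.pow 2)).const_mul k).neg
    exact (htan y hy).continuousAt.continuousWithinAt
  · intro y hy
    have hfd : HasDerivWithinAt f (r y) (Ioi y) y := by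
      have := (hf.neg.differentiableWithinAt_Ioi_of_mem_interior
        (by rwa [interior_Icc] : y ∈ interior (Icc a b))).neg
      simp only [neg_neg] at this
      exact DifferentiableWithinAt.hasDerivWithinAt this
    have h2 : HasDerivWithinAt (fun y => f y ^ 2) (2 * f y * r y) (Ioi y) y := by
      simpa using hfd.fun_pow 2
    exact ((((htan y (Ioo_subset_Icc_self hy)).hasDerivWithinAt.mul h2)).const_mul k).neg
  · exact hrint.sub (hfint.const_mul _)
  · intro y hy
    have hc' := (hcos y (Ioo_subset_Icc_self hy))
    have h3 : 1 / cos (θ y) ^ 2 = 1 + tan (θ y) ^ 2 := by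
      rw [← inv_one_add_tan_sq hc'.ne']; simp
    simp only [h3]
    nlinarith [sq_nonneg (r y + k * tan (θ y) * f y)]

/-- Wirtinger's inequality for a concave function vanishing at the endpoints. -/
lemma ConcaveOn.integral_sq_le_integral_deriv_sq {f v : ℝ → ℝ} {a b : ℝ} (hab : a ≤ b)
    (hc : ContinuousOn f (Icc a b)) (hf : ConcaveOn ℝ (Icc a b) f) (ha : f a = 0) (hb : f b = 0)
    (hv : ∀ᵐ y, y ∈ Icc a b → HasDerivAt f (v y) y)
    (hint : IntegrableOn (fun y => v y ^ 2) (Icc a b)) :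
    ∫ y in a..b, f y ^ 2 ≤ ((b - a) / π) ^ 2 * ∫ y in a..b, v y ^ 2 := by
  rcases hab.eq_or_lt with rfl | hlt
  · simp
  have hL : 0 < b - a := sub_pos.2 hlt
  have hK : 0 < π / (b - a) := div_pos pi_pos hL
  have hlim : (π / (b - a)) ^ 2 * ∫ y in a..b, f y ^ 2 ≤ ∫ y in a..b, v y ^ 2 := by
    have ht : Tendsto (fun k : ℝ => k ^ 2 * ∫ y in a..b, f y ^ 2) (𝓝[<] (π / (b - a)))
        (𝓝 ((π / (b - a)) ^ 2 * ∫ y in a..b, f y ^ 2)) :=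
      tendsto_nhdsWithin_of_tendsto_nhds (Continuous.tendsto (by fun_prop) _)
    refine le_of_tendsto ht ?_
    filter_upwards [Ioo_mem_nhdsLT hK] with k hk
    exact hf.mul_integral_sq_le_integral_deriv_sq hab hc ha hb hv hint hk.1.le
      ((lt_div_iff₀ hL).1 hk.2)
  have h1 := mul_le_mul_of_nonneg_left hlim (sq_nonneg ((b - a) / π))
  have h2 : ((b - a) / π) ^ 2 * (π / (b - a)) ^ 2 = 1 := by
    have := pi_pos.ne'
    field_simp
  rwa [← mul_assoc, h2, one_mul] at h1

/-- A concave function lies below its tangent plane. -/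
lemma ConcaveOn.le_add_fderiv {E : Type*} [NormedAddCommGroup E] [NormedSpace ℝ E] {s : Set E}
    {u : E → ℝ} (hu : ConcaveOn ℝ s u) {p q : E} (hp : p ∈ s) (hq : q ∈ s)
    (hd : DifferentiableAt ℝ u p) : u q ≤ u p + fderiv ℝ u p (q - p) := by
  have hg : ConcaveOn ℝ (AffineMap.lineMap p q ⁻¹' s) (u ∘ (AffineMap.lineMap p q : ℝ →ᵃ[ℝ] E)) :=
    hu.comp_affineMap _
  have hg' : HasDerivAt (u ∘ (AffineMap.lineMap p q : ℝ →ᵃ[ℝ] E)) (fderiv ℝ u p (q - p)) 0 := by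
    have h0 : HasFDerivAt u (fderiv ℝ u p) ((AffineMap.lineMap p q : ℝ →ᵃ[ℝ] E) 0) := by
      simpa using hd.hasFDerivAt
    exact h0.comp_hasDerivAt 0 AffineMap.hasDerivAt_lineMap
  have := hg.slope_le_of_hasDerivAt (x := 0) (y := 1) (by simpa) (by simpa) one_pos hg'
  simp [slope_def_field] at this
  rw [map_sub]
  linarith

/-- Parametric interval integrals of a bounded measurable function, with interval endpoints
varying continuously, are integrable over a bounded open interval. -/
lemma integrableOn_Ioo_intervalIntegral {φ ψ : ℝ → ℝ} {g : ℝ × ℝ → ℝ} {a b C M : ℝ}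
    (hφ : ContinuousOn φ (Ioo a b)) (hψ : ContinuousOn ψ (Ioo a b))
    (hle : ∀ x ∈ Ioo a b, φ x ≤ ψ x) (hM : ∀ x ∈ Ioo a b, ψ x - φ x ≤ M)
    (hg : Measurable g) (hC0 : 0 ≤ C)
    (hC : ∀ x ∈ Ioo a b, ∀ y ∈ Icc (φ x) (ψ x), ‖g (x, y)‖ ≤ C) :
    IntegrableOn (fun x => ∫ y in φ x..ψ x, g (x, y)) (Ioo a b) := by
  classical
  have hmeas : ∀ {f : ℝ → ℝ}, ContinuousOn f (Ioo a b) →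
      Measurable ((Ioo a b).piecewise f (fun _ => 0)) := fun hf =>
    hf.measurable_piecewise continuousOn_const measurableSet_Ioo
  set φ' := (Ioo a b).piecewise φ (fun _ => 0)
  set ψ' := (Ioo a b).piecewise ψ (fun _ => 0)
  have hS := measurableSet_region_between_oc (hmeas hφ) (hmeas hψ)
    (measurableSet_Ioo (a := a) (b := b))
  have hsm : StronglyMeasurable (fun x : ℝ => ∫ y, indicator
      {p : ℝ × ℝ | p.1 ∈ Ioo a b ∧ p.2 ∈ Ioc (φ' p.1) (ψ' p.1)} g (x, y)) :=
    (hg.indicator hS).stronglyMeasurable.integral_prod_right'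
  refine Integrable.of_bound (C := C * M) ?_ ?_
  · refine hsm.aestronglyMeasurable.congr ?_
    filter_upwards [ae_restrict_mem measurableSet_Ioo] with x hx
    rw [intervalIntegral.integral_of_le (hle x hx), ← integral_indicator measurableSet_Ioc]
    congr 1 with y
    have h1 : φ' x = φ x := piecewise_eq_of_mem _ _ _ hx
    have h2 : ψ' x = ψ x := piecewise_eq_of_mem _ _ _ hx
    by_cases hy : y ∈ Ioc (φ x) (ψ x)
    · rw [indicator_of_mem hy, indicator_of_mem]
      exact ⟨hx, by simpa only [h1, h2] using hy⟩
    · rw [indicator_of_notMem hy, indicator_of_notMem]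
      rintro ⟨-, h⟩
      exact hy (by simpa only [h1, h2] using h)
  · filter_upwards [ae_restrict_mem measurableSet_Ioo] with x hx
    have := intervalIntegral.norm_integral_le_of_norm_le_const (a := φ x) (b := ψ x)
      (f := fun y => g (x, y)) (C := C) fun y hy => by
        rw [uIoc_of_le (hle x hx)] at hy
        exact hC x hx y (Ioc_subset_Icc_self hy)
    rw [abs_of_nonneg (sub_nonneg.2 (hle x hx))] at this
    exact this.trans (mul_le_mul_of_nonneg_left (hM x hx) hC0)

/-- Pointwise bound for `u_x` on the left half, from the tangent plane inequality at the two
extreme points `(0,0)` and `(2,0)`. -/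
lemma uX_sq_le {Ω : Set (ℝ × ℝ)} {u : ℝ × ℝ → ℝ} (hu : ConcaveOn ℝ Ω u)
    (h0 : ((0 : ℝ), (0 : ℝ)) ∈ Ω) (h2 : ((2 : ℝ), (0 : ℝ)) ∈ Ω)
    (hu0 : u ((0 : ℝ), (0 : ℝ)) = 0) (hu2 : u ((2 : ℝ), (0 : ℝ)) = 0) {x y m : ℝ}
    (hx : 0 < x) (hx1 : x ≤ 1) (hp : (x, y) ∈ Ω) (hy : |y| ≤ m * x)
    (hd : DifferentiableAt ℝ u (x, y)) :
    uX u (x, y) ^ 2 ≤ 2 / x ^ 2 * u (x, y) ^ 2 + 2 * m ^ 2 * uY u (x, y) ^ 2 := by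
  have hlin : ∀ s t : ℝ, fderiv ℝ u (x, y) (s, t) = s * uX u (x, y) + t * uY u (x, y) := by
    intro s t
    have : ((s, t) : ℝ × ℝ) = s • ((1 : ℝ), (0 : ℝ)) + t • ((0 : ℝ), (1 : ℝ)) := by simp
    rw [this, map_add, map_smul, map_smul]
    rfl
  have hA := hu.le_add_fderiv hp h0 hd
  have hB := hu.le_add_fderiv hp h2 hd
  rw [Prod.mk_sub_mk, hlin, hu0] at hA
  rw [Prod.mk_sub_mk, hlin, hu2] at hB
  set U := u (x, y)
  set X := uX u (x, y)
  set Y := uY u (x, y)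
  have hw : 0 ≤ U - y * Y := by nlinarith
  have hXw : |x * X| ≤ U - y * Y := abs_le.2 ⟨by nlinarith, by linarith⟩
  have hsq : (x * X) ^ 2 ≤ (U - y * Y) ^ 2 := sq_le_sq.2 (hXw.trans (le_abs_self _))
  have hyy : y ^ 2 ≤ (m * x) ^ 2 := sq_le_sq.2 (hy.trans (le_abs_self _))
  have hfin : x ^ 2 * X ^ 2 ≤ 2 * U ^ 2 + 2 * m ^ 2 * Y ^ 2 * x ^ 2 := by
    nlinarith [sq_nonneg (U + y * Y), mul_le_mul_of_nonneg_right hyy (sq_nonneg Y)]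
  have hx2 : 0 < x ^ 2 := by positivity
  refine le_of_mul_le_mul_left (hfin.trans_eq ?_) hx2
  field_simp

/-- For `Ω` between the graphs of a convex `φ₁` and a concave `φ₂` on `[0,2]` vanishing
at the endpoints, with `m = max(|φ₁'(0⁺)|, |φ₂'(0⁺)|)`, every `u ∈ U_Ω` satisfies
`I_x ≤ 2m²(1 + 4/π²) I_y` on the left half. -/
theorem stmt10 (φ₁ φ₂ : ℝ → ℝ)
    (hφ₁ : ConvexOn ℝ (Icc (0 : ℝ) 2) φ₁) (hφ₂ : ConcaveOn ℝ (Icc (0 : ℝ) 2) φ₂)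
    (hle : ∀ x ∈ Icc (0 : ℝ) 2, φ₁ x ≤ φ₂ x)
    (h10 : φ₁ 0 = 0) (h20 : φ₂ 0 = 0) (h12 : φ₁ 2 = 0) (h22 : φ₂ 2 = 0)
    (Ω : Set (ℝ × ℝ))
    (hΩ : Ω = {p : ℝ × ℝ | p.1 ∈ Icc (0 : ℝ) 2 ∧ p.2 ∈ Icc (φ₁ p.1) (φ₂ p.1)})
    (hint : (interior Ω).Nonempty)
    (d₁ d₂ m : ℝ) (hd₁ : HasDerivWithinAt φ₁ d₁ (Ici (0 : ℝ)) 0)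
    (hd₂ : HasDerivWithinAt φ₂ d₂ (Ici (0 : ℝ)) 0) (hm : m = max |d₁| |d₂|)
    (u : ℝ × ℝ → ℝ) (hu : MemU Ω u) :
    (∫ x in (0 : ℝ)..1, ∫ y in φ₁ x..φ₂ x, (uX u (x, y)) ^ 2) ≤
      2 * m ^ 2 * (1 + 4 / π ^ 2) *
        ∫ x in (0 : ℝ)..1, ∫ y in φ₁ x..φ₂ x, (uY u (x, y)) ^ 2 := by
  obtain ⟨hcont, hconc, hdiff, ⟨C, hC⟩, hfr⟩ := hu
  have hmem : ∀ x y : ℝ, (x, y) ∈ Ω ↔ x ∈ Icc (0 : ℝ) 2 ∧ y ∈ Icc (φ₁ x) (φ₂ x) := by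
    intro x y; rw [hΩ]; rfl
  -- points of `Ω` approximated by points outside lie on the frontier
  have hfront : ∀ (p : ℝ × ℝ) (v : ℝ × ℝ), p ∈ Ω → (∀ t > (0 : ℝ), p + t • v ∉ Ω) → u p = 0 := by
    intro p v hp hv
    refine hfr p ⟨subset_closure hp, fun hpi => ?_⟩
    have ht : Tendsto (fun t : ℝ => p + t • v) (𝓝[>] 0) (𝓝 p) :=
      tendsto_nhdsWithin_of_tendsto_nhds (by
        simpa using (Continuous.tendsto (f := fun t : ℝ => p + t • v) (by fun_prop) 0))
    obtain ⟨t, ht1, ht2⟩ :=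
      ((ht.eventually (mem_interior_iff_mem_nhds.1 hpi)).and self_mem_nhdsWithin).exists
    exact hv t ht2 ht1
  have h0Ω : ((0 : ℝ), (0 : ℝ)) ∈ Ω := by rw [hmem]; simp [h10, h20]
  have h2Ω : ((2 : ℝ), (0 : ℝ)) ∈ Ω := by rw [hmem]; simp [h12, h22]
  have hu0 : u ((0 : ℝ), (0 : ℝ)) = 0 := by
    refine hfront _ (-1, 0) h0Ω fun t ht h => ?_
    have := ((hmem _ _).1 h).1.1
    simp at this
    linarith
  have hu2 : u ((2 : ℝ), (0 : ℝ)) = 0 := by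
    refine hfront _ (1, 0) h2Ω fun t ht h => ?_
    have := ((hmem _ _).1 h).1.2
    simp at this
    linarith
  have hI : ∀ x ∈ Ioo (0 : ℝ) 1, x ∈ Icc (0 : ℝ) 2 := fun x hx => ⟨hx.1.le, by linarith [hx.2]⟩
  have hub : ∀ x ∈ Ioo (0 : ℝ) 1, u (x, φ₁ x) = 0 := by
    intro x hx
    refine hfront _ (0, -1) ((hmem _ _).2 ⟨hI x hx, le_rfl, hle x (hI x hx)⟩) fun t ht h => ?_
    have := ((hmem _ _).1 h).2.1
    simp at this
    linarith
  have hut : ∀ x ∈ Ioo (0 : ℝ) 1, u (x, φ₂ x) = 0 := by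
    intro x hx
    refine hfront _ (0, 1) ((hmem _ _).2 ⟨hI x hx, hle x (hI x hx), le_rfl⟩) fun t ht h => ?_
    have := ((hmem _ _).1 h).2.2
    simp at this
    linarith
  have hm0 : 0 ≤ m := hm ▸ (abs_nonneg d₁).trans (le_max_left _ _)
  have hz : (0 : ℝ) ∈ Icc (0 : ℝ) 2 := by simp
  have hlow : ∀ x ∈ Ioo (0 : ℝ) 1, -(m * x) ≤ φ₁ x := by
    intro x hx
    have := hφ₁.le_slope_of_hasDerivWithinAt_Ioi hz (hI x hx) hx.1 (hd₁.mono Ioi_subset_Ici_self)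
    rw [slope_def_field, h10, sub_zero, sub_zero, le_div_iff₀ hx.1] at this
    have h1 : -d₁ ≤ m := hm ▸ (neg_le_abs d₁).trans (le_max_left _ _)
    nlinarith [mul_le_mul_of_nonneg_right h1 hx.1.le]
  have hupp : ∀ x ∈ Ioo (0 : ℝ) 1, φ₂ x ≤ m * x := by
    intro x hx
    have := hφ₂.slope_le_of_hasDerivWithinAt_Ioi hz (hI x hx) hx.1 (hd₂.mono Ioi_subset_Ici_self)
    rw [slope_def_field, h20, sub_zero, sub_zero, div_le_iff₀ hx.1] at this
    have h1 : d₂ ≤ m := hm ▸ (le_abs_self d₂).trans (le_max_right _ _)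
    nlinarith [mul_le_mul_of_nonneg_right h1 hx.1.le]
  -- bounds for the partial derivatives
  have hbd : ∀ p ∈ Ω, ∀ e : ℝ × ℝ, ‖e‖ ≤ 1 → ‖fderiv ℝ u p e ^ 2‖ ≤ C ^ 2 := by
    intro p hp e he
    rw [norm_pow]
    by_cases hd : DifferentiableAt ℝ u p
    · have h1 := hC p hp hd
      refine pow_le_pow_left₀ (norm_nonneg _) ?_ 2
      exact ((fderiv ℝ u p).le_of_opNorm_le h1 e).trans
        (mul_le_of_le_one_right ((norm_nonneg _).trans h1) he)
    · simpa [fderiv_zero_of_not_differentiableAt hd] using sq_nonneg C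
  have hmX : Measurable (fun p => uX u p ^ 2) := (measurable_fderiv_apply_const ℝ u _).pow_const 2
  have hmY : Measurable (fun p => uY u p ^ 2) := (measurable_fderiv_apply_const ℝ u _).pow_const 2
  have hslice : ∀ g : ℝ × ℝ → ℝ, Measurable g → (∀ p ∈ Ω, ‖g p‖ ≤ C ^ 2) → ∀ x ∈ Ioo (0 : ℝ) 1,
      IntegrableOn (fun y => g (x, y)) (Icc (φ₁ x) (φ₂ x)) := by
    intro g hg hgb x hx
    refine Measure.integrableOn_of_bounded (M := C ^ 2) (by simp)
      (hg.comp measurable_prodMk_left).aestronglyMeasurable ?_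
    filter_upwards [ae_restrict_mem measurableSet_Icc] with y hy
    exact hgb _ ((hmem _ _).2 ⟨hI x hx, hy⟩)
  have hXint := hslice _ hmX fun p hp => hbd p hp _ (by simp)
  have hYint := hslice _ hmY fun p hp => hbd p hp _ (by simp)
  have hae : ∀ᵐ x : ℝ, ∀ᵐ y : ℝ, (x, y) ∈ Ω → DifferentiableAt ℝ u (x, y) :=
    Measure.ae_ae_of_ae_prod (ae_imp_of_ae_restrict hdiff)
  -- the inequality on almost every vertical slice
  have hinner : ∀ᵐ x ∂(volume.restrict (Ioo (0 : ℝ) 1)),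
      (∫ y in φ₁ x..φ₂ x, uX u (x, y) ^ 2) ≤
        2 * m ^ 2 * (1 + 4 / π ^ 2) * ∫ y in φ₁ x..φ₂ x, uY u (x, y) ^ 2 := by
    filter_upwards [ae_restrict_of_ae hae, ae_restrict_mem measurableSet_Ioo] with x hdx hx
    have hlex := hle x (hI x hx)
    have hin : ∀ y ∈ Icc (φ₁ x) (φ₂ x), (x, y) ∈ Ω := fun y hy => (hmem _ _).2 ⟨hI x hx, hy⟩
    have huc : ContinuousOn (fun y => u (x, y)) (Icc (φ₁ x) (φ₂ x)) :=
      hcont.comp (by fun_prop) fun y hy => subset_closure (hin y hy)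
    have hfc : ConcaveOn ℝ (Icc (φ₁ x) (φ₂ x)) (fun y => u (x, y)) := by
      refine ⟨convex_Icc _ _, fun y hy z hz s t hs ht hst => ?_⟩
      have := hconc.2 (hin y hy) (hin z hz) hs ht hst
      have hxx : s * x + t * x = x := by rw [← add_mul, hst, one_mul]
      simpa [hxx] using this
    have hder : ∀ᵐ y, y ∈ Icc (φ₁ x) (φ₂ x) → HasDerivAt (fun y => u (x, y)) (uY u (x, y)) y := by
      filter_upwards [hdx] with y hy hyI
      exact (hy (hin y hyI)).hasFDerivAt.comp_hasDerivAt y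
        ((hasDerivAt_const y x).prodMk (hasDerivAt_id y))
    have hW := hfc.integral_sq_le_integral_deriv_sq hlex huc (hub x hx) (hut x hx) hder (hYint x hx)
    have hYi : IntervalIntegrable (fun y => uY u (x, y) ^ 2) volume (φ₁ x) (φ₂ x) :=
      (intervalIntegrable_iff_integrableOn_Icc_of_le hlex).2 (hYint x hx)
    have hui : IntervalIntegrable (fun y => u (x, y) ^ 2) volume (φ₁ x) (φ₂ x) :=
      (huc.pow 2).intervalIntegrable_of_Icc hlex
    have hmono : (∫ y in φ₁ x..φ₂ x, uX u (x, y) ^ 2) ≤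
        ∫ y in φ₁ x..φ₂ x, (2 / x ^ 2 * u (x, y) ^ 2 + 2 * m ^ 2 * uY u (x, y) ^ 2) := by
      refine intervalIntegral.integral_mono_ae_restrict hlex
        ((intervalIntegrable_iff_integrableOn_Icc_of_le hlex).2 (hXint x hx))
        ((hui.const_mul _).add (hYi.const_mul _)) ?_
      filter_upwards [ae_restrict_of_ae hdx, ae_restrict_mem measurableSet_Icc] with y hy hyI
      exact uX_sq_le hconc h0Ω h2Ω hu0 hu2 hx.1 hx.2.le (hin y hyI)
        (abs_le.2 ⟨(hlow x hx).trans hyI.1, hyI.2.trans (hupp x hx)⟩) (hy (hin y hyI))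
    rw [intervalIntegral.integral_add (hui.const_mul _) (hYi.const_mul _),
      intervalIntegral.integral_const_mul, intervalIntegral.integral_const_mul] at hmono
    have hJ : 0 ≤ ∫ y in φ₁ x..φ₂ x, uY u (x, y) ^ 2 :=
      intervalIntegral.integral_nonneg hlex fun y _ => sq_nonneg _
    have hL : ((φ₂ x - φ₁ x) / π) ^ 2 ≤ (2 * m * x / π) ^ 2 := by
      have := pi_pos
      refine pow_le_pow_left₀ (div_nonneg (sub_nonneg.2 hlex) this.le) ?_ 2
      gcongr
      linarith [hlow x hx, hupp x hx]
    have hW' := mul_le_mul_of_nonneg_left (hW.trans (mul_le_mul_of_nonneg_right hL hJ))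
      (by positivity : 0 ≤ 2 / x ^ 2)
    have hx0 := hx.1.ne'
    have hπ := pi_pos.ne'
    calc _ ≤ _ := hmono
      _ ≤ _ := add_le_add_left hW' _
      _ = _ := by field_simp; ring
  have houter : IntegrableOn (fun x => ∫ y in φ₁ x..φ₂ x, uY u (x, y) ^ 2) (Ioo (0 : ℝ) 1) := by
    have hsub : Ioo (0 : ℝ) 1 ⊆ interior (Icc (0 : ℝ) 2) := by
      rw [interior_Icc]
      exact Ioo_subset_Ioo_right one_le_two
    refine integrableOn_Ioo_intervalIntegral (M := 2 * m) (g := fun p => uY u p ^ 2)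
      (hφ₁.continuousOn_interior.mono hsub) (hφ₂.continuousOn_interior.mono hsub)
      (fun x hx => hle x (hI x hx)) (fun x hx => ?_) hmY (sq_nonneg C)
      fun x hx y hy => hbd _ ((hmem _ _).2 ⟨hI x hx, hy⟩) _ (by simp)
    nlinarith [hlow x hx, hupp x hx, hx.2]
  rw [intervalIntegral.integral_of_le zero_le_one, intervalIntegral.integral_of_le zero_le_one,
    integral_Ioc_eq_integral_Ioo, integral_Ioc_eq_integral_Ioo, ← integral_const_mul]
  refine integral_mono_of_nonneg ?_ (houter.const_mul _) hinner
  filter_upwards [ae_restrict_mem measurableSet_Ioo] with x hx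
  exact intervalIntegral.integral_nonneg (hle x (hI x hx)) fun y _ => sq_nonneg _
end

section
/- Let Ω ⊂ ℝ² be a convex bounded set with nonempty interior contained in the cone with vertex at its left corner O bounded by the two rays from O with director vectors (sin α, cos α) and (sin α, −cos α), where 0 < α ≤ π/4, and let 0 < φ < α. Then for every u ∈ U_Ω with max_Ω u = 1, the set Ω_{++} = {(x,y) ∈ Ω : u_x(x,y) ≥ 0, u_y(x,y) ≥ 0, |u_y(x,y)| ≤ tan φ · |u_x(x,y)|} satisfies ∫_{Ω_{++}} |∇u|² dx dy ≤ (sin(α+φ)/sin(α−φ)) · cot α. -/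
open MeasureTheory Real Set Filter Asymptotics

/-- The gradient inequality for concave functions. -/
theorem ConcaveOn.sub_le_fderiv_apply {E : Type*} [NormedAddCommGroup E] [NormedSpace ℝ E]
    {s : Set E} {u : E → ℝ} (hu : ConcaveOn ℝ s u) {p p' : E} (hp : p ∈ s) (hp' : p' ∈ s)
    (hd : DifferentiableAt ℝ u p) : u p' - u p ≤ fderiv ℝ u p (p' - p) := by
  have hc := hu.comp_affineMap (AffineMap.lineMap p p' : ℝ →ᵃ[ℝ] E)
  have hder : HasDerivAt (u ∘ (AffineMap.lineMap p p' : ℝ →ᵃ[ℝ] E))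
      (fderiv ℝ u p (p' - p)) 0 := by
    have h1 : HasFDerivAt u (fderiv ℝ u p) ((AffineMap.lineMap p p' : ℝ →ᵃ[ℝ] E) 0) := by
      simpa using hd.hasFDerivAt
    exact h1.comp_hasDerivAt 0 AffineMap.hasDerivAt_lineMap
  have h := hc.slope_le_of_hasDerivAt (x := 0) (y := 1) (by simpa using hp) (by simpa using hp')
    zero_lt_one hder
  simpa [slope_def_field] using h

open scoped Topology in
/-- The gradient inequality for concave functions, at points of the closure. -/
theorem ConcaveOn.sub_le_fderiv_apply_of_mem_closure {E : Type*} [NormedAddCommGroup E]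
    [NormedSpace ℝ E] {s : Set E} {u : E → ℝ} (hu : ConcaveOn ℝ s u)
    (huc : ContinuousOn u (closure s)) {p p' : E} (hp : p ∈ s) (hp' : p' ∈ closure s)
    (hd : DifferentiableAt ℝ u p) : u p' - u p ≤ fderiv ℝ u p (p' - p) := by
  have hne : (𝓝[s] p').NeBot := mem_closure_iff_nhdsWithin_neBot.1 hp'
  have h1 : Tendsto (fun z => u z - u p) (𝓝[s] p') (𝓝 (u p' - u p)) :=
    ((huc p' hp').mono subset_closure).sub_const _
  have h2 : Tendsto (fun z => fderiv ℝ u p (z - p)) (𝓝[s] p') (𝓝 (fderiv ℝ u p (p' - p))) := by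
    have : Continuous fun z => fderiv ℝ u p (z - p) := by fun_prop
    exact this.continuousWithinAt
  exact le_of_tendsto_of_tendsto h1 h2
    (eventually_mem_nhdsWithin.mono fun z hz => hu.sub_le_fderiv_apply hp hz hd)

/-- A one-dimensional energy estimate: `∫ t g'² ≤ ∫ g g' ≤ 1/2`. -/
theorem lintegral_mul_deriv_sq_le {A : Set ℝ} (hA : MeasurableSet A) {g g' : ℝ → ℝ}
    (hd : ∀ t ∈ A, HasDerivAt g (g' t) t) (hmono : MonotoneOn g A)
    (hg' : ∀ t ∈ A, 0 ≤ g' t) (hg0 : ∀ t ∈ A, 0 ≤ g t) (hg1 : ∀ t ∈ A, g t ≤ 1)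
    (hle : ∀ t ∈ A, t * g' t ≤ g t) :
    ∫⁻ t in A, ENNReal.ofReal (t * g' t ^ 2) ≤ ENNReal.ofReal (1 / 2) := by
  calc ∫⁻ t in A, ENNReal.ofReal (t * g' t ^ 2)
      ≤ ∫⁻ t in A, ENNReal.ofReal (g t * g' t) := by
        refine setLIntegral_mono' hA fun t ht => ENNReal.ofReal_le_ofReal ?_
        nlinarith [mul_le_mul_of_nonneg_right (hle t ht) (hg' t ht)]
    _ = volume ((fun t => g t ^ 2 / 2) '' A) := by
        refine lintegral_deriv_eq_volume_image_of_monotoneOn hA (fun t ht => ?_) ?_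
        · have := (((hd t ht).pow 2).div_const 2).hasDerivWithinAt (s := A)
          exact this.congr_deriv (by push_cast; ring)
        · intro s hs t ht hst
          have h1 := hmono hs ht hst
          have h2 := hg0 s hs
          simp only
          gcongr
    _ ≤ volume (Icc (0 : ℝ) (1 / 2)) := by
        refine measure_mono ?_
        rintro _ ⟨t, ht, rfl⟩
        have h1 := hg1 t ht
        have h2 := hg0 t ht
        constructor
        · positivity
        · simp only
          nlinarith
    _ = ENNReal.ofReal (1 / 2) := by simp

/-- Integration along the rays `{(x, x q) : x > 0}` issued from the origin. -/
theorem lintegral_eq_lintegral_slope {G : ℝ × ℝ → ENNReal} (hG : Measurable G)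
    (h0 : ∀ p : ℝ × ℝ, p.1 ≤ 0 → G p = 0) :
    ∫⁻ p, G p = ∫⁻ q : ℝ, ∫⁻ x in Ioi (0 : ℝ), ENNReal.ofReal x * G (x, x * q) := by
  rw [lintegral_lintegral_swap (by fun_prop), Measure.volume_eq_prod,
    lintegral_prod _ hG.aemeasurable, ← lintegral_indicator measurableSet_Ioi]
  refine lintegral_congr fun x => ?_
  by_cases hx : 0 < x
  · have hxm : x ∈ Ioi (0 : ℝ) := hx
    rw [indicator_of_mem hxm]
    conv_lhs => rw [← Real.smul_map_volume_mul_left hx.ne']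
    rw [lintegral_smul_measure, lintegral_map (by fun_prop) (by fun_prop), abs_of_pos hx,
      lintegral_const_mul _ (by fun_prop), smul_eq_mul]
  · have hxm : x ∉ Ioi (0 : ℝ) := hx
    rw [indicator_of_notMem hxm]
    simp [h0 (x, _) (not_lt.1 hx)]

/-- The angular weight bounding the ratio of `|∇u|²` to the squared derivative along a ray. -/
noncomputable def rayWeight (K q : ℝ) : ℝ := (1 + K ^ 2) / (1 + K * min q 0) ^ 2

theorem one_add_mul_pos {K C q : ℝ} (hK : 0 ≤ K) (hKC : K * C < 1) (hq : -C ≤ q) :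
    0 < 1 + K * q := by
  nlinarith

theorem sq_add_sq_le_rayWeight_mul {K C q a b : ℝ} (hK : 0 ≤ K) (hC : 0 ≤ C) (hKC : K * C < 1)
    (hq : -C ≤ q) (ha : 0 ≤ a) (hb : 0 ≤ b) (hba : b ≤ K * a) :
    a ^ 2 + b ^ 2 ≤ rayWeight K q * (a + q * b) ^ 2 := by
  have hm : 0 < 1 + K * min q 0 := one_add_mul_pos hK hKC (le_min hq (by linarith))
  rw [rayWeight, div_mul_eq_mul_div, le_div_iff₀ (by positivity)]
  have h1 : a * (1 + K * min q 0) ≤ a + q * b := by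
    rcases le_total q 0 with h | h
    · rw [min_eq_left h]; nlinarith
    · rw [min_eq_right h]; nlinarith [mul_nonneg h hb]
  have h2 : a ^ 2 + b ^ 2 ≤ (1 + K ^ 2) * a ^ 2 := by nlinarith
  calc (a ^ 2 + b ^ 2) * (1 + K * min q 0) ^ 2
      ≤ (1 + K ^ 2) * a ^ 2 * (1 + K * min q 0) ^ 2 := by gcongr
    _ = (1 + K ^ 2) * (a * (1 + K * min q 0)) ^ 2 := by ring
    _ ≤ (1 + K ^ 2) * (a + q * b) ^ 2 := by gcongr

theorem continuousOn_rayWeight {K C : ℝ} (hK : 0 ≤ K) (hC : 0 ≤ C) (hKC : K * C < 1) :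
    ContinuousOn (rayWeight K) (Icc (-C) C) := by
  unfold rayWeight
  refine ContinuousOn.div (by fun_prop) (by fun_prop) fun q hq => ?_
  have := one_add_mul_pos hK hKC (le_min hq.1 (by linarith : -C ≤ 0))
  positivity

theorem integral_rayWeight {K C : ℝ} (hK : 0 ≤ K) (hC : 0 ≤ C) (hKC : K * C < 1) :
    ∫ q in (-C)..C, rayWeight K q = (1 + K ^ 2) * (C / (1 - K * C) + C) := by
  have hcont := continuousOn_rayWeight hK hC hKC
  have hi1 : IntervalIntegrable (rayWeight K) volume (-C) 0 :=
    (hcont.mono (Icc_subset_Icc le_rfl hC)).intervalIntegrable_of_Icc (by linarith)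
  have hi2 : IntervalIntegrable (rayWeight K) volume 0 C :=
    (hcont.mono (Icc_subset_Icc (by linarith) le_rfl)).intervalIntegrable_of_Icc hC
  rw [← intervalIntegral.integral_add_adjacent_intervals hi1 hi2]
  have e1 : ∫ q in (-C)..0, rayWeight K q = (1 + K ^ 2) * (C / (1 - K * C)) := by
    have hne : 1 - K * C ≠ 0 := by linarith
    rw [intervalIntegral.integral_eq_sub_of_hasDerivAt
      (f := fun q => (1 + K ^ 2) * (q / (1 + K * q))) (f' := rayWeight K) ?_ hi1]
    · simp only [zero_div, mul_zero, mul_neg, zero_sub, neg_div, neg_neg, ← sub_eq_add_neg]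
    · intro q hq
      rw [uIcc_of_le (by linarith)] at hq
      have hpos := one_add_mul_pos hK hKC hq.1
      have h1 : HasDerivAt (fun q : ℝ => 1 + K * q) K q := by
        simpa using ((hasDerivAt_id q).const_mul K).const_add 1
      have h2 := ((hasDerivAt_id q).div h1 hpos.ne').const_mul (1 + K ^ 2)
      refine h2.congr_deriv ?_
      simp only [rayWeight, min_eq_left hq.2, id]
      ring
  have e2 : ∫ q in (0)..C, rayWeight K q = (1 + K ^ 2) * C := by
    have : ∫ q in (0)..C, rayWeight K q = ∫ q in (0)..C, (1 + K ^ 2) := by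
      refine intervalIntegral.integral_congr fun q hq => ?_
      rw [uIcc_of_le hC] at hq
      simp [rayWeight, min_eq_right hq.1]
    rw [this, intervalIntegral.integral_const]
    simp; ring
  rw [e1, e2]; ring

theorem setLIntegral_rayWeight {K C : ℝ} (hK : 0 ≤ K) (hC : 0 ≤ C) (hKC : K * C < 1) :
    ∫⁻ q in Icc (-C) C, ENNReal.ofReal (rayWeight K q) =
      ENNReal.ofReal ((1 + K ^ 2) * (C / (1 - K * C) + C)) := by
  rw [← integral_rayWeight hK hC hKC, intervalIntegral.integral_of_le (by linarith),
    ← integral_Icc_eq_integral_Ioc, ofReal_integral_eq_lintegral_ofReal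
      ((continuousOn_rayWeight hK hC hKC).integrableOn_Icc)]
  exact Eventually.of_forall fun q => by simp only [rayWeight, Pi.zero_apply]; positivity

theorem interior_fst_pos {Ω : Set (ℝ × ℝ)} {a : ℝ} (h : ∀ q ∈ Ω, a ≤ q.1) {p : ℝ × ℝ}
    (hp : p ∈ interior Ω) : a < p.1 := by
  have h1 : interior Ω ⊆ interior (Prod.fst ⁻¹' Ici a) := interior_mono fun q hq => h q hq
  have h2 := h1 hp
  rw [← isOpenMap_fst.preimage_interior_eq_interior_preimage continuous_fst, interior_Ici] at h2
  exact h2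

/-- The points of `interior Ω` where `u` is differentiable with gradient in the sector
`0 ≤ u_y ≤ K u_x`. -/
def gradSector (Ω : Set (ℝ × ℝ)) (u : ℝ × ℝ → ℝ) (K : ℝ) : Set (ℝ × ℝ) :=
  interior Ω ∩ {p | DifferentiableAt ℝ u p} ∩ {p | 0 ≤ uX u p ∧ 0 ≤ uY u p ∧ uY u p ≤ K * uX u p}

theorem measurable_uX (u : ℝ × ℝ → ℝ) : Measurable (uX u) :=
  measurable_fderiv_apply_const ℝ u (1, 0)

theorem measurable_uY (u : ℝ × ℝ → ℝ) : Measurable (uY u) :=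
  measurable_fderiv_apply_const ℝ u (0, 1)

theorem measurableSet_gradSector (Ω : Set (ℝ × ℝ)) (u : ℝ × ℝ → ℝ) (K : ℝ) :
    MeasurableSet (gradSector Ω u K) := by
  have hx := measurable_uX u
  have hy := measurable_uY u
  refine (isOpen_interior.measurableSet.inter (measurableSet_of_differentiableAt ℝ u)).inter ?_
  exact (measurableSet_le measurable_const hx).inter
    ((measurableSet_le measurable_const hy).inter (measurableSet_le hy (hx.const_mul K)))

theorem fderiv_apply_eq_uX_add_uY (u : ℝ × ℝ → ℝ) (p v : ℝ × ℝ) :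
    fderiv ℝ u p v = v.1 * uX u p + v.2 * uY u p := by
  have : v = v.1 • ((1 : ℝ), (0 : ℝ)) + v.2 • ((0 : ℝ), (1 : ℝ)) := by ext <;> simp
  conv_lhs => rw [this]
  simp only [map_add, map_smul, smul_eq_mul, uX, uY]

/-- The energy of `u` along a ray of slope `q` issued from `O`. -/
theorem lintegral_ray_le {Ω : Set (ℝ × ℝ)} {u : ℝ × ℝ → ℝ} {O : ℝ × ℝ} {K C : ℝ}
    (hu : MemU Ω u) (hO : O ∈ closure Ω) (huO : u O = 0) (hle : ∀ p ∈ Ω, u p ≤ 1)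
    (hK : 0 ≤ K) (hC : 0 ≤ C) (hKC : K * C < 1)
    (hcone : ∀ q ∈ Ω, 0 ≤ q.1 - O.1 ∧ |q.2 - O.2| ≤ (q.1 - O.1) * C) (q : ℝ) :
    ∫⁻ x in Ioi (0 : ℝ), ENNReal.ofReal x * (gradSector Ω u K).indicator
        (fun p => ENNReal.ofReal (uX u p ^ 2 + uY u p ^ 2)) (O + (x, x * q)) ≤
      (Icc (-C) C).indicator (fun q => ENNReal.ofReal (rayWeight K q)) q *
        ENNReal.ofReal (1 / 2) := by
  set S := gradSector Ω u K with hS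
  have hSΩ : ∀ p ∈ S, p ∈ Ω := fun p hp => interior_subset hp.1.1
  by_cases hq : q ∈ Icc (-C) C
  · set γ : ℝ → ℝ × ℝ := fun x => O + (x, x * q) with hγ
    have hγm : Measurable γ := by fun_prop
    set A : Set ℝ := Ioi 0 ∩ γ ⁻¹' S with hA
    have hAm : MeasurableSet A := measurableSet_Ioi.inter (hγm (measurableSet_gradSector Ω u K))
    set g' : ℝ → ℝ := fun x => uX u (γ x) + q * uY u (γ x) with hg'
    have hγd : ∀ x, HasDerivAt γ (1, q) x := fun x => by
      have h1 : HasDerivAt (fun x : ℝ => (x, x * q)) (1, q) x := by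
        simpa using (hasDerivAt_id x).prodMk ((hasDerivAt_id x).mul_const q)
      exact h1.const_add O
    have hg'0 : ∀ t ∈ A, 0 ≤ g' t := by
      rintro t ⟨-, ht⟩
      obtain ⟨-, h1, h2, h3⟩ := ht
      have h4 : -(C * uY u (γ t)) ≤ q * uY u (γ t) := by
        have := mul_le_mul_of_nonneg_right hq.1 h2
        linarith
      have h5 : C * uY u (γ t) ≤ C * (K * uX u (γ t)) := mul_le_mul_of_nonneg_left h3 hC
      have h6 : K * C * uX u (γ t) ≤ 1 * uX u (γ t) := mul_le_mul_of_nonneg_right hKC.le h1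
      simp only [hg']
      linarith
    have hgrad : ∀ t ∈ A, ∀ s, γ s ∈ closure Ω → u (γ s) - u (γ t) ≤ (s - t) * g' t := by
      intro t ht s hs
      have h := hu.2.1.sub_le_fderiv_apply_of_mem_closure hu.1 (hSΩ _ ht.2) hs ht.2.1.2
      rw [fderiv_apply_eq_uX_add_uY] at h
      simp only [hγ, hg', Prod.fst_sub, Prod.snd_sub, Prod.fst_add, Prod.snd_add] at h ⊢
      linarith
    have hleg : ∀ t ∈ A, t * g' t ≤ u (γ t) := by
      intro t ht
      have h0 : γ 0 = O := by simp [hγ]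
      have h := hgrad t ht 0 (by rw [h0]; exact hO)
      rw [h0, huO] at h
      linarith
    have hen : ∫⁻ t in A, ENNReal.ofReal (t * g' t ^ 2) ≤ ENNReal.ofReal (1 / 2) := by
      refine lintegral_mul_deriv_sq_le hAm (g := fun t => u (γ t)) ?_ ?_ hg'0 ?_ ?_ hleg
      · intro t ht
        have h := ht.2.1.2.hasFDerivAt.comp_hasDerivAt t (hγd t)
        rw [fderiv_apply_eq_uX_add_uY] at h
        simp only [one_mul] at h
        exact h
      · intro s hs t ht hst
        have h := hgrad t ht s (subset_closure (hSΩ _ hs.2))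
        have h' := mul_nonneg (sub_nonneg.2 hst) (hg'0 t ht)
        simp only
        linarith
      · exact fun t ht => (mul_nonneg (le_of_lt ht.1) (hg'0 t ht)).trans (hleg t ht)
      · exact fun t ht => hle _ (hSΩ _ ht.2)
    rw [indicator_of_mem hq]
    calc _ = ∫⁻ x in A, ENNReal.ofReal (x * (uX u (γ x) ^ 2 + uY u (γ x) ^ 2)) := by
          rw [← lintegral_indicator measurableSet_Ioi, ← lintegral_indicator hAm]
          refine lintegral_congr fun x => ?_
          by_cases hx : x ∈ Ioi (0 : ℝ)
          · by_cases hxS : γ x ∈ S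
            · rw [indicator_of_mem hx, indicator_of_mem (show x ∈ A from ⟨hx, hxS⟩),
                indicator_of_mem hxS, ENNReal.ofReal_mul (le_of_lt hx)]
            · rw [indicator_of_mem hx, indicator_of_notMem (fun h : x ∈ A => hxS h.2),
                indicator_of_notMem hxS, mul_zero]
          · rw [indicator_of_notMem hx, indicator_of_notMem (fun h : x ∈ A => hx h.1)]
      _ ≤ ∫⁻ x in A, ENNReal.ofReal (rayWeight K q) * ENNReal.ofReal (x * g' x ^ 2) := by
          refine setLIntegral_mono' hAm fun x hx => ?_
          have hw : 0 ≤ rayWeight K q := by unfold rayWeight; positivity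
          rw [← ENNReal.ofReal_mul hw]
          refine ENNReal.ofReal_le_ofReal ?_
          have h := sq_add_sq_le_rayWeight_mul hK hC hKC hq.1 hx.2.2.1 hx.2.2.2.1 hx.2.2.2.2
          have := mul_le_mul_of_nonneg_left h (le_of_lt hx.1)
          simp only [hg']
          linarith
      _ ≤ _ := by
          rw [lintegral_const_mul' _ _ ENNReal.ofReal_ne_top]
          gcongr
  · rw [indicator_of_notMem hq, zero_mul, nonpos_iff_eq_zero]
    rw [← lintegral_zero (μ := volume.restrict (Ioi (0 : ℝ)))]
    refine setLIntegral_congr_fun measurableSet_Ioi fun x hx => ?_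
    have hx0 : (0 : ℝ) < x := hx
    rw [indicator_of_notMem, mul_zero]
    intro hxS
    have h := (hcone _ (hSΩ _ hxS)).2
    simp only [Prod.fst_add, Prod.snd_add, add_sub_cancel_left, abs_mul, abs_of_pos hx0] at h
    exact hq (abs_le.1 (le_of_mul_le_mul_left h hx0))

/-- The Dirichlet energy of `u` over `gradSector Ω u K`. -/
theorem lintegral_gradSector_le {Ω : Set (ℝ × ℝ)} {u : ℝ × ℝ → ℝ} {O : ℝ × ℝ} {K C : ℝ}
    (hu : MemU Ω u) (hO : O ∈ closure Ω) (hle : ∀ p ∈ Ω, u p ≤ 1)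
    (hK : 0 ≤ K) (hC : 0 ≤ C) (hKC : K * C < 1)
    (hcone : ∀ q ∈ Ω, 0 ≤ q.1 - O.1 ∧ |q.2 - O.2| ≤ (q.1 - O.1) * C) :
    ∫⁻ p in gradSector Ω u K, ENNReal.ofReal (uX u p ^ 2 + uY u p ^ 2) ≤
      ENNReal.ofReal ((1 + K ^ 2) * (C / (1 - K * C) + C) / 2) := by
  have hpos : ∀ p ∈ interior Ω, O.1 < p.1 := fun p hp =>
    interior_fst_pos (fun q hq => by linarith [(hcone q hq).1]) hp
  have huO : u O = 0 := hu.2.2.2.2 O ⟨hO, fun h => (hpos O h).false⟩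
  have hX := measurable_uX u
  have hY := measurable_uY u
  have hSm := measurableSet_gradSector Ω u K
  rw [← lintegral_indicator hSm]
  set G := (gradSector Ω u K).indicator
    (fun p => ENNReal.ofReal (uX u p ^ 2 + uY u p ^ 2)) with hG
  have hGm : Measurable G := Measurable.indicator (by fun_prop) hSm
  rw [← lintegral_add_left_eq_self G O, lintegral_eq_lintegral_slope (by fun_prop)]
  · calc _ ≤ ∫⁻ q, (Icc (-C) C).indicator (fun q => ENNReal.ofReal (rayWeight K q)) q *
          ENNReal.ofReal (1 / 2) :=
          lintegral_mono fun q => lintegral_ray_le hu hO huO hle hK hC hKC hcone q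
      _ = _ := by
          rw [lintegral_mul_const' _ _ ENNReal.ofReal_ne_top,
            lintegral_indicator measurableSet_Icc, setLIntegral_rayWeight hK hC hKC,
            ← ENNReal.ofReal_mul' (by norm_num)]
          congr 1; ring
  · intro p hp
    refine indicator_of_notMem (fun h => ?_) _
    have := hpos _ h.1.1
    simp only [Prod.fst_add] at this
    linarith

theorem rayWeight_mass_le {K C : ℝ} (hK : 0 ≤ K) (hC : 1 ≤ C) (hKC : K * C < 1) :
    (1 + K ^ 2) * (C / (1 - K * C) + C) / 2 ≤ (1 + K * C) / (1 - K * C) * C := by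
  have h1 : 0 < 1 - K * C := by linarith
  have e : (1 + K ^ 2) * (C / (1 - K * C) + C) / 2 =
      (1 + K ^ 2) * (2 - K * C) / 2 * C / (1 - K * C) := by
    field_simp; ring
  rw [e, div_mul_eq_mul_div (1 + K * C)]
  have h2 : K ≤ K * C := le_mul_of_one_le_right hK hC
  have h3 : K ^ 2 ≤ (K * C) ^ 2 := by gcongr
  have h4 : 0 ≤ K * C := by positivity
  refine div_le_div_of_nonneg_right (mul_le_mul_of_nonneg_right ?_ (zero_le_one.trans hC)) h1.le
  generalize K * C = s at *
  nlinarith [mul_nonneg h4 h4, mul_le_mul_of_nonneg_right h3 (by linarith : 0 ≤ 2 - s),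
    mul_nonneg h4 (mul_nonneg h4 h4)]

/-- If `Ω` lies in the cone at its left corner `O` spanned by `(sin α, cos α)` and
`(sin α, -cos α)`, `0 < φ < α ≤ π/4`, then every `u ∈ U_Ω` with `max_Ω u = 1` satisfies
`∫_{Ω_{++}} |∇u|² ≤ (sin(α+φ)/sin(α-φ)) · cot α`. -/
theorem stmt13 (Ω : Set (ℝ × ℝ)) (hconv : Convex ℝ Ω) (hbdd : Bornology.IsBounded Ω)
    (hint : (interior Ω).Nonempty)
    (O : ℝ × ℝ) (hO : O ∈ closure Ω) (hOx : O.1 = leftX Ω)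
    (α : ℝ) (hα0 : 0 < α) (hα1 : α ≤ π / 4)
    (hcone : ∀ q ∈ Ω, 0 ≤ q.1 - O.1 ∧
      |q.2 - O.2| ≤ (q.1 - O.1) * (Real.cos α / Real.sin α))
    (φ : ℝ) (hφ0 : 0 < φ) (hφα : φ < α)
    (u : ℝ × ℝ → ℝ) (hu : MemU Ω u)
    (hle : ∀ p ∈ Ω, u p ≤ 1) (hmax : ∃ p ∈ Ω, u p = 1) :
    (∫ p in {p ∈ Ω | 0 ≤ uX u p ∧ 0 ≤ uY u p ∧ |uY u p| ≤ Real.tan φ * |uX u p|},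
      ((uX u p) ^ 2 + (uY u p) ^ 2)) ≤
      (Real.sin (α + φ) / Real.sin (α - φ)) * (Real.cos α / Real.sin α) := by
  set K := Real.tan φ with hKdef
  set C := Real.cos α / Real.sin α with hCdef
  have hpi := Real.pi_pos
  have hsα : 0 < Real.sin α := Real.sin_pos_of_pos_of_lt_pi hα0 (by linarith)
  have hcφ : 0 < Real.cos φ := Real.cos_pos_of_mem_Ioo ⟨by linarith, by linarith⟩
  have hsφ : 0 < Real.sin φ := Real.sin_pos_of_pos_of_lt_pi hφ0 (by linarith)
  have hsub : 0 < Real.sin (α - φ) :=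
    Real.sin_pos_of_pos_of_lt_pi (by linarith) (by linarith)
  have hK : 0 ≤ K := by rw [hKdef, Real.tan_eq_sin_div_cos]; positivity
  have hC1 : 1 ≤ C := by
    rw [hCdef, one_le_div hsα, ← Real.cos_pi_div_two_sub]
    exact Real.cos_le_cos_of_nonneg_of_le_pi hα0.le (by linarith) (by linarith)
  have hd : 1 - K * C = Real.sin (α - φ) / (Real.sin α * Real.cos φ) := by
    rw [hKdef, hCdef, Real.tan_eq_sin_div_cos, Real.sin_sub]; field_simp
  have hs : 1 + K * C = Real.sin (α + φ) / (Real.sin α * Real.cos φ) := by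
    rw [hKdef, hCdef, Real.tan_eq_sin_div_cos, Real.sin_add]; field_simp
  have hKC : K * C < 1 := by
    have : 0 < 1 - K * C := by rw [hd]; positivity
    linarith
  have hratio : Real.sin (α + φ) / Real.sin (α - φ) = (1 + K * C) / (1 - K * C) := by
    rw [hd, hs]; field_simp
  rw [hratio]
  refine le_trans ?_ (rayWeight_mass_le hK hC1 hKC)
  have hX := measurable_uX u
  have hY := measurable_uY u
  rw [integral_eq_lintegral_of_nonneg_ae (Eventually.of_forall fun p => by positivity)
    (by fun_prop : Measurable fun p => uX u p ^ 2 + uY u p ^ 2).aestronglyMeasurable]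
  have hden : 0 < 1 - K * C := by linarith
  refine ENNReal.toReal_le_of_le_ofReal (by positivity) ?_
  refine le_trans ?_ (lintegral_gradSector_le hu hO hle hK (by linarith) hKC hcone)
  set S := {p ∈ Ω | 0 ≤ uX u p ∧ 0 ≤ uY u p ∧ |uY u p| ≤ K * |uX u p|} with hS
  refine lintegral_mono_set' ?_ 
  have hfr : ∀ᵐ p : ℝ × ℝ, p ∉ frontier Ω :=
    measure_eq_zero_iff_ae_notMem.1 (hconv.addHaar_frontier volume)
  have hdiff : ∀ᵐ p : ℝ × ℝ, p ∈ interior Ω → DifferentiableAt ℝ u p := by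
    rw [← ae_restrict_iff' isOpen_interior.measurableSet]
    exact ae_restrict_of_ae_restrict_of_subset interior_subset hu.2.2.1
  filter_upwards [hfr, hdiff] with p hp hpd hpS
  obtain ⟨h1, h2, h3, h4⟩ := hpS
  have hpi : p ∈ interior Ω := by
    by_contra h
    exact hp ⟨subset_closure h1, h⟩
  rw [abs_of_nonneg h2, abs_of_nonneg h3] at h4
  exact ⟨⟨hpi, hpd hpi⟩, h2, h3, h4⟩
end

section
/- Let Ω ⊂ ℝ² be a convex bounded set with nonempty interior such that both vertical support lines of Ω are angular. Let β ∈ (0, π/2) be such that the (unique) support line at every regular point of ∂Ω forms an angle at least β with the vertical direction, and let h be the maximum distance between a point of Ω and a line of support to Ω. Then every u ∈ U_Ω with max_Ω u = 1 satisfies ∫_Ω u_y² dx dy ≥ (sin² β / h²) · |Ω|, where |Ω| is the area of Ω. -/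
open MeasureTheory Real Set Filter Asymptotics

/-- A concave function on an open interval is differentiable at some point of it. -/
theorem ConcaveOn.exists_differentiableAt_Ioo {f : ℝ → ℝ} {a b : ℝ} (hab : a < b)
    (hf : ConcaveOn ℝ (Ioo a b) f) : ∃ x ∈ Ioo a b, DifferentiableAt ℝ f x := by
  obtain ⟨m, hm⟩ := exists_between hab
  obtain ⟨K, t, ht, hK⟩ := hf.locallyLipschitzOn isOpen_Ioo hm
  rw [isOpen_Ioo.nhdsWithin_eq hm] at ht
  obtain ⟨c, d, hcd, hsub⟩ := mem_nhds_iff_exists_Ioo_subset.1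
    (Filter.inter_mem ht (isOpen_Ioo.mem_nhds hm))
  have hae := (hK.mono (fun x hx => (hsub hx).1)).ae_differentiableWithinAt_of_mem_real
  have hdense := Measure.dense_of_ae hae
  obtain ⟨x, hx, hxd⟩ := hdense.exists_mem_open isOpen_Ioo ⟨m, hcd⟩
  exact ⟨x, (hsub hxd).2, (hx hxd).differentiableAt (isOpen_Ioo.mem_nhds hxd)⟩

/-- The line tangent to the graph of a concave function lies above the graph. -/
theorem ConcaveOn.le_tangent {S : Set ℝ} {f : ℝ → ℝ} (hf : ConcaveOn ℝ S f) {x y d : ℝ}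
    (hx : x ∈ S) (hy : y ∈ S) (hd : HasDerivAt f d x) : f y ≤ f x + d * (y - x) := by
  rcases lt_trichotomy x y with h | h | h
  · have := hf.slope_le_of_hasDerivAt hx hy h hd
    rw [slope_def_field, div_le_iff₀ (by linarith)] at this
    linarith
  · subst h; simp
  · have := hf.le_slope_of_hasDerivAt hy hx h hd
    rw [slope_def_field, le_div_iff₀ (by linarith)] at this
    linarith

/-- The ordinate of the highest point of `K` on the vertical line with abscissa `x`. -/
noncomputable def upperBoundary (K : Set (ℝ × ℝ)) (x : ℝ) : ℝ := sSup {y | (x, y) ∈ K}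

section upperBoundary

variable {K : Set (ℝ × ℝ)}

theorem isCompact_verticalSlice (hK : IsCompact K) (x : ℝ) : IsCompact {y | (x, y) ∈ K} := by
  have : {y | (x, y) ∈ K} = Prod.snd '' (K ∩ Prod.fst ⁻¹' {x}) := by
    ext y
    simp
  rw [this]
  exact (hK.inter_right (isClosed_singleton.preimage continuous_fst)).image continuous_snd

theorem le_upperBoundary (hK : IsCompact K) {q : ℝ × ℝ} (hq : q ∈ K) :
    q.2 ≤ upperBoundary K q.1 :=
  le_csSup (isCompact_verticalSlice hK q.1).bddAbove hq

theorem upperBoundary_mem (hK : IsCompact K) {x : ℝ} (hx : x ∈ Prod.fst '' K) :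
    (x, upperBoundary K x) ∈ K := by
  obtain ⟨q, hq, rfl⟩ := hx
  exact (isCompact_verticalSlice hK q.1).sSup_mem ⟨q.2, hq⟩

theorem concaveOn_upperBoundary (hK : IsCompact K) (hconv : Convex ℝ K) :
    ConcaveOn ℝ (Prod.fst '' K) (upperBoundary K) := by
  refine ⟨hconv.linear_image (LinearMap.fst ℝ ℝ ℝ), fun x hx y hy a b ha hb hab => ?_⟩
  exact le_upperBoundary hK
    (hconv (upperBoundary_mem hK hx) (upperBoundary_mem hK hy) ha hb hab)

end upperBoundary

/-- `n` is, up to scaling, the only outward normal of `K` at `ξ`. -/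
def IsUniqueSupportDir (K : Set (ℝ × ℝ)) (ξ n : ℝ × ℝ) : Prop :=
  IsSupportDir K ξ n ∧ ∀ m, IsSupportDir K ξ m → ∃ t : ℝ, m = t • n

theorem isUniqueSupportDir_upperBoundary {K : Set (ℝ × ℝ)} (hK : IsCompact K)
    (hconv : Convex ℝ K) {x d : ℝ} (hx : Prod.fst '' K ∈ nhds x)
    (hd : HasDerivAt (upperBoundary K) d x) :
    IsUniqueSupportDir K (x, upperBoundary K x) (-d, 1) := by
  have hxK : x ∈ Prod.fst '' K := mem_of_mem_nhds hx
  refine ⟨⟨by simp, fun q hq => ?_⟩, fun m hm => ?_⟩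
  · have h1 := (concaveOn_upperBoundary hK hconv).le_tangent hxK (mem_image_of_mem _ hq) hd
    have h2 := le_upperBoundary hK hq
    simp only
    linarith
  · have hmax : IsLocalMax (fun y => m.1 * y + m.2 * upperBoundary K y) x := by
      filter_upwards [hx] with y hy
      exact hm.2 _ (upperBoundary_mem hK hy)
    have hder : HasDerivAt (fun y => m.1 * y + m.2 * upperBoundary K y) (m.1 * 1 + m.2 * d) x :=
      ((hasDerivAt_id x).const_mul m.1).add (hd.const_mul m.2)
    have h0 := hmax.hasDerivAt_eq_zero hder
    refine ⟨m.2, Prod.ext ?_ ?_⟩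
    · simp only [Prod.smul_fst, smul_eq_mul]
      linarith
    · simp

/-- If the rightmost point of `K` is angular and every regular support line is not too steep and
passes at height at most `k` above `p`, then to the right of `p` the set `K` lies below the line
through the rightmost point and the point at height `k` above `p`. -/
theorem le_chord_of_isUniqueSupportDir {K : Set (ℝ × ℝ)} (hK : IsCompact K)
    (hconv : Convex ℝ K) {p P : ℝ × ℝ} {C μ k : ℝ} (hp : p ∈ K) (hP : P ∈ K) (hpP : p.1 < P.1)
    (hC : 0 ≤ C) (hμ : 0 ≤ μ)
    (hang : ∀ q ∈ K, |q.2 - P.2| ≤ C * |q.1 - P.1|)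
    (hsupp : ∀ ξ ∈ K, ∀ n, IsUniqueSupportDir K ξ n → |n.1| ≤ μ * |n.2| ∧
      n.1 * (ξ.1 - p.1) + n.2 * (ξ.2 - p.2) ≤ k * |n.2|)
    {q : ℝ × ℝ} (hq : q ∈ K) (hpq : p.1 ≤ q.1) (hqP : q.1 ≤ P.1) :
    (P.1 - p.1) * q.2 ≤ (P.1 - q.1) * (p.2 + k) + (q.1 - p.1) * P.2 := by
  have hcc := concaveOn_upperBoundary hK hconv
  have hIcc : Icc p.1 P.1 ⊆ Prod.fst '' K :=
    hcc.1.ordConnected.out (mem_image_of_mem _ hp) (mem_image_of_mem _ hP)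
  refine le_of_forall_pos_le_add fun ε hε => ?_
  set D := P.1 - p.1 with hD
  have hD0 : 0 < D := by linarith
  obtain ⟨δ, hδ0, hδ⟩ : ∃ δ > 0, D * ((C + μ) * δ) ≤ ε := by
    refine ⟨ε / (D * (C + μ + 1)), by positivity, ?_⟩
    rw [show D * ((C + μ) * (ε / (D * (C + μ + 1)))) = ε * ((C + μ) / (C + μ + 1)) by
      field_simp]
    refine mul_le_of_le_one_right hε.le ?_
    rw [div_le_one (by positivity)]
    linarith
  obtain ⟨x, ⟨hx1, hx2⟩, hdiff⟩ := ConcaveOn.exists_differentiableAt_Ioo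
    (max_lt hpP (show P.1 - δ < P.1 by linarith))
    (hcc.subset (fun x hx => hIcc ⟨(le_max_left _ _).trans hx.1.le, hx.2.le⟩) (convex_Ioo _ _))
  obtain ⟨hx3, hx4⟩ := max_lt_iff.1 hx1
  have hnhds : Prod.fst '' K ∈ nhds x := mem_of_superset (Icc_mem_nhds hx3 hx2) hIcc
  have hxK := mem_of_mem_nhds hnhds
  have huniq := isUniqueSupportDir_upperBoundary hK hconv hnhds hdiff.hasDerivAt
  set d := deriv (upperBoundary K) x
  set B := upperBoundary K x
  obtain ⟨h1, h2⟩ := hsupp _ (upperBoundary_mem hK hxK) _ huniq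
  have h3 := hang _ (upperBoundary_mem hK hxK)
  have h4 := huniq.1.2 q hq
  simp only [abs_one, mul_one, abs_neg, one_mul] at h1 h2 h3 h4
  rw [abs_sub_comm x, abs_of_pos (show 0 < P.1 - x by linarith)] at h3
  have h5 : B + d * (P.1 - x) ≤ P.2 + (C + μ) * δ := by
    have e1 : d * (P.1 - x) ≤ μ * (P.1 - x) :=
      mul_le_mul_of_nonneg_right ((le_abs_self d).trans h1) (by linarith)
    have e2 : (C + μ) * (P.1 - x) ≤ (C + μ) * δ :=
      mul_le_mul_of_nonneg_left (by linarith) (by positivity)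
    linarith [(le_abs_self _).trans h3]
  have h6 : B + d * (p.1 - x) ≤ p.2 + k := by linarith
  have h7 : q.2 ≤ B + d * (q.1 - x) := by linarith
  calc D * q.2 ≤ D * (B + d * (q.1 - x)) := mul_le_mul_of_nonneg_left h7 hD0.le
    _ = (P.1 - q.1) * (B + d * (p.1 - x)) + (q.1 - p.1) * (B + d * (P.1 - x)) := by
      rw [hD]; ring
    _ ≤ (P.1 - q.1) * (p.2 + k) + (q.1 - p.1) * (P.2 + (C + μ) * δ) :=
      add_le_add (mul_le_mul_of_nonneg_left h6 (by linarith))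
        (mul_le_mul_of_nonneg_left h5 (by linarith))
    _ ≤ (P.1 - q.1) * (p.2 + k) + (q.1 - p.1) * P.2 + ε := by
      have : (q.1 - p.1) * ((C + μ) * δ) ≤ D * ((C + μ) * δ) :=
        mul_le_mul_of_nonneg_right (by linarith) (by positivity)
      linarith

theorem convex_reflection {K : Set (ℝ × ℝ)} (hconv : Convex ℝ K) (σ τ : ℝ) :
    Convex ℝ {q : ℝ × ℝ | (σ * q.1, τ * q.2) ∈ K} := by
  intro x hx y hy a b ha hb hab
  have := hconv hx hy ha hb hab
  simp only [mem_ofPred_eq, Prod.smul_mk, Prod.mk_add_mk, smul_eq_mul, Prod.fst_add, Prod.snd_add,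
    Prod.smul_fst, Prod.smul_snd] at this ⊢
  convert this using 2 <;> ring

theorem isCompact_reflection {K : Set (ℝ × ℝ)} (hK : IsCompact K) {σ τ : ℝ} (hσ : σ * σ = 1)
    (hτ : τ * τ = 1) : IsCompact {q : ℝ × ℝ | (σ * q.1, τ * q.2) ∈ K} := by
  convert hK.image (f := fun q : ℝ × ℝ => (σ * q.1, τ * q.2)) (by fun_prop) using 1
  ext q
  refine ⟨fun hq => ⟨_, hq, ?_⟩, ?_⟩
  · simp [← mul_assoc, hσ, hτ]
  · rintro ⟨r, hr, rfl⟩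
    simpa [← mul_assoc, hσ, hτ] using hr

theorem IsSupportDir.of_reflection {K : Set (ℝ × ℝ)} {σ τ : ℝ} (hσ : σ * σ = 1)
    (hτ : τ * τ = 1) {ξ n : ℝ × ℝ}
    (h : IsSupportDir {q : ℝ × ℝ | (σ * q.1, τ * q.2) ∈ K} ξ n) :
    IsSupportDir K (σ * ξ.1, τ * ξ.2) (σ * n.1, τ * n.2) := by
  refine ⟨fun h0 => h.1 ?_, fun q hq => ?_⟩
  · obtain ⟨h1, h2⟩ := Prod.mk.inj h0
    refine Prod.ext ?_ ?_
    · rw [← one_mul n.1, ← hσ, mul_assoc, h1]; simp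
    · rw [← one_mul n.2, ← hτ, mul_assoc, h2]; simp
  · have := h.2 (σ * q.1, τ * q.2) (by simpa [← mul_assoc, hσ, hτ] using hq)
    simp only at this ⊢
    linear_combination this - (n.1 * ξ.1) * hσ - (n.2 * ξ.2) * hτ

theorem IsSupportDir.reflection {K : Set (ℝ × ℝ)} {σ τ : ℝ} (hσ : σ * σ = 1)
    (hτ : τ * τ = 1) {ξ n : ℝ × ℝ} (h : IsSupportDir K (σ * ξ.1, τ * ξ.2) n) :
    IsSupportDir {q : ℝ × ℝ | (σ * q.1, τ * q.2) ∈ K} ξ (σ * n.1, τ * n.2) := by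
  refine ⟨fun h0 => h.1 ?_, fun q hq => ?_⟩
  · obtain ⟨h1, h2⟩ := Prod.mk.inj h0
    refine Prod.ext ?_ ?_
    · rw [← one_mul n.1, ← hσ, mul_assoc, h1]; simp
    · rw [← one_mul n.2, ← hτ, mul_assoc, h2]; simp
  · have := h.2 (σ * q.1, τ * q.2) hq
    simp only at this ⊢
    linear_combination this

theorem IsUniqueSupportDir.of_reflection {K : Set (ℝ × ℝ)} {σ τ : ℝ} (hσ : σ * σ = 1)
    (hτ : τ * τ = 1) {ξ n : ℝ × ℝ}
    (h : IsUniqueSupportDir {q : ℝ × ℝ | (σ * q.1, τ * q.2) ∈ K} ξ n) :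
    IsUniqueSupportDir K (σ * ξ.1, τ * ξ.2) (σ * n.1, τ * n.2) := by
  refine ⟨h.1.of_reflection hσ hτ, fun m hm => ?_⟩
  obtain ⟨t, ht⟩ := h.2 _ (hm.reflection hσ hτ)
  obtain ⟨h1, h2⟩ := Prod.mk.inj ht
  refine ⟨t, Prod.ext ?_ ?_⟩
  · simp only [smul_eq_mul, Prod.smul_mk] at h1 ⊢
    linear_combination σ * h1 - m.1 * hσ
  · simp only [smul_eq_mul, Prod.smul_mk] at h2 ⊢
    linear_combination τ * h2 - m.2 * hτ

theorem le_chord_of_isUniqueSupportDir_reflection {K : Set (ℝ × ℝ)} (hK : IsCompact K)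
    (hconv : Convex ℝ K) {σ τ : ℝ} (hσ : σ * σ = 1) (hτ : τ * τ = 1) {p P : ℝ × ℝ} {C μ k : ℝ}
    (hp : p ∈ K) (hP : P ∈ K) (hpP : σ * p.1 < σ * P.1) (hC : 0 ≤ C) (hμ : 0 ≤ μ)
    (hang : ∀ q ∈ K, |q.2 - P.2| ≤ C * |q.1 - P.1|)
    (hsupp : ∀ ξ ∈ K, ∀ n, IsUniqueSupportDir K ξ n → |n.1| ≤ μ * |n.2| ∧
      n.1 * (ξ.1 - p.1) + n.2 * (ξ.2 - p.2) ≤ k * |n.2|)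
    {q : ℝ × ℝ} (hq : q ∈ K) (hpq : σ * p.1 ≤ σ * q.1) (hqP : σ * q.1 ≤ σ * P.1) :
    σ * (P.1 - p.1) * (τ * q.2) ≤
      σ * (P.1 - q.1) * (τ * p.2 + k) + σ * (q.1 - p.1) * (τ * P.2) := by
  have hσa : |σ| = 1 := by
    rcases mul_self_eq_one_iff.1 hσ with h | h <;> simp [h]
  have hτa : |τ| = 1 := by
    rcases mul_self_eq_one_iff.1 hτ with h | h <;> simp [h]
  have hmem : ∀ r ∈ K, (σ * r.1, τ * r.2) ∈ {q : ℝ × ℝ | (σ * q.1, τ * q.2) ∈ K} := by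
    intro r hr
    simpa [← mul_assoc, hσ, hτ] using hr
  have := le_chord_of_isUniqueSupportDir (isCompact_reflection hK hσ hτ)
    (convex_reflection hconv σ τ) (p := (σ * p.1, τ * p.2)) (P := (σ * P.1, τ * P.2))
    (C := C) (μ := μ) (k := k) (hmem p hp) (hmem P hP) hpP hC hμ ?_ ?_ (hmem q hq) hpq hqP
  · simp only at this
    linear_combination this
  · intro r hr
    have h := hang _ hr
    have e1 : r.2 - τ * P.2 = τ * (τ * r.2 - P.2) := by linear_combination -r.2 * hτ
    have e2 : r.1 - σ * P.1 = σ * (σ * r.1 - P.1) := by linear_combination -r.1 * hσ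
    simpa only [e1, e2, abs_mul, hσa, hτa, one_mul] using h
  · intro ξ hξ n hn
    obtain ⟨h1, h2⟩ := hsupp _ hξ _ (hn.of_reflection hσ hτ)
    simp only [abs_mul, hσa, hτa, one_mul] at h1 h2
    refine ⟨h1, ?_⟩
    simp only
    linear_combination h2 - (n.1 * ξ.1) * hσ - (n.2 * ξ.2) * hτ

/-- The vertical distance from a point `q` of `K` to the segment joining `p` to an angular extreme
point `P` on the same side of `p`. -/
theorem abs_sub_chord_le_of_isUniqueSupportDir {K : Set (ℝ × ℝ)} (hK : IsCompact K)
    (hconv : Convex ℝ K) {p P : ℝ × ℝ} {C μ k : ℝ} (hp : p ∈ K) (hP : P ∈ K) (hC : 0 ≤ C)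
    (hμ : 0 ≤ μ) (hang : ∀ q ∈ K, |q.2 - P.2| ≤ C * |q.1 - P.1|)
    (hsupp : ∀ ξ ∈ K, ∀ n, IsUniqueSupportDir K ξ n → |n.1| ≤ μ * |n.2| ∧
      n.1 * (ξ.1 - p.1) + n.2 * (ξ.2 - p.2) ≤ k * |n.2|)
    {σ : ℝ} (hσ : σ * σ = 1) (hpP : σ * p.1 < σ * P.1)
    {q : ℝ × ℝ} (hq : q ∈ K) (hpq : σ * p.1 ≤ σ * q.1) (hqP : σ * q.1 ≤ σ * P.1) :
    |q.2 - ((P.1 - q.1) / (P.1 - p.1) * p.2 + (q.1 - p.1) / (P.1 - p.1) * P.2)| ≤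
      (P.1 - q.1) / (P.1 - p.1) * k := by
  have hne : P.1 - p.1 ≠ 0 := fun h0 => by
    rw [sub_eq_zero.1 h0] at hpP
    exact lt_irrefl _ hpP
  have hpos : 0 < σ * (P.1 - p.1) := by linarith
  have key : ∀ τ : ℝ, τ * τ = 1 → τ * (q.2 - ((P.1 - q.1) / (P.1 - p.1) * p.2 +
      (q.1 - p.1) / (P.1 - p.1) * P.2)) ≤ (P.1 - q.1) / (P.1 - p.1) * k := by
    intro τ hτ
    have h := le_chord_of_isUniqueSupportDir_reflection hK hconv hσ hτ hp hP hpP hC hμ hang hsupp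
      hq hpq hqP
    refine le_of_mul_le_mul_left ?_ hpos
    have e1 : (P.1 - p.1) * ((P.1 - q.1) / (P.1 - p.1)) = P.1 - q.1 := by field_simp
    have e2 : (P.1 - p.1) * ((q.1 - p.1) / (P.1 - p.1)) = q.1 - p.1 := by field_simp
    linear_combination h - (σ * τ * p.2 + σ * k) * e1 - (σ * τ * P.2) * e2
  rw [abs_le]
  constructor
  · linarith [key (-1) (by norm_num)]
  · linarith [key 1 (by norm_num)]

/-- A one-dimensional energy estimate for concave functions vanishing at the endpoints. -/
theorem sq_mul_length_le_integral_sq_of_concaveOn {w g : ℝ → ℝ} {a b c s : ℝ}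
    (hc : c ∈ Ioo a b) (hs : 0 ≤ s)
    (hw : ConcaveOn ℝ (Ioo a b) w) (hcont : ContinuousOn w (Icc a b)) (ha : w a = 0)
    (hb : w b = 0) (hsa : s * (c - a) ≤ w c) (hsb : s * (b - c) ≤ w c)
    (hg : IntegrableOn g (Ioo a b)) (hg2 : IntegrableOn (fun y => g y ^ 2) (Ioo a b))
    (hder : ∀ᵐ y, y ∈ Ioo a b → HasDerivAt w (g y) y) :
    s ^ 2 * (b - a) ≤ ∫ y in Ioo a b, g y ^ 2 := by
  have hright : ∀ y ∈ Ioo a b, HasDerivWithinAt w (derivWithin w (Ioi y) y) (Ioi y) y := by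
    intro y hy
    have := (hw.neg.differentiableWithinAt_Ioi_of_mem_interior
      (by rwa [interior_Ioo])).neg.hasDerivWithinAt
    simpa using this.differentiableWithinAt.hasDerivWithinAt
  have hae : ∀ᵐ y, y ∈ Ioo a b → derivWithin w (Ioi y) y = g y := by
    filter_upwards [hder] with y hy hyab
    exact ((hy hyab).hasDerivWithinAt).derivWithin (uniqueDiffWithinAt_Ioi y)
  have hFTC : ∀ c d, a ≤ c → c ≤ d → d ≤ b → IntervalIntegrable g volume c d ∧
      IntervalIntegrable (fun y => g y ^ 2) volume c d ∧ ∫ y in c..d, g y = w d - w c := by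
    intro c d hac hcd hdb
    have hsub : Ioo c d ⊆ Ioo a b := Ioo_subset_Ioo hac hdb
    have hgi : IntervalIntegrable g volume c d :=
      (intervalIntegrable_iff_integrableOn_Ioo_of_le hcd).2 (hg.mono_set hsub)
    have hae' : ∀ᵐ y, y ∈ Set.uIoc c d → derivWithin w (Ioi y) y = g y := by
      have hd : ∀ᵐ y : ℝ, y ≠ d := Measure.ae_ne volume d
      filter_upwards [hae, hd] with y hy hyd hycd
      rw [uIoc_of_le hcd] at hycd
      exact hy (hsub ⟨hycd.1, lt_of_le_of_ne hycd.2 hyd⟩)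
    refine ⟨hgi, (intervalIntegrable_iff_integrableOn_Ioo_of_le hcd).2 (hg2.mono_set hsub), ?_⟩
    rw [← intervalIntegral.integral_congr_ae hae']
    refine intervalIntegral.integral_eq_sub_of_hasDeriv_right_of_le hcd
      (hcont.mono (Icc_subset_Icc hac hdb)) (fun y hy => hright y (hsub hy)) ?_
    refine hgi.congr_ae ?_
    rw [Filter.EventuallyEq, ae_restrict_iff' measurableSet_uIoc]
    filter_upwards [hae'] with y hy hyc using (hy hyc).symm
  obtain ⟨i1, i2, i3⟩ := hFTC a c le_rfl hc.1.le hc.2.le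
  obtain ⟨j1, j2, j3⟩ := hFTC c b hc.1.le hc.2.le le_rfl
  have hl : ∫ y in a..c, (2 * s * g y - s ^ 2) ≤ ∫ y in a..c, g y ^ 2 :=
    intervalIntegral.integral_mono_on hc.1.le ((i1.const_mul _).sub intervalIntegrable_const) i2
      fun y _ => by nlinarith [sq_nonneg (g y - s)]
  have hr : ∫ y in c..b, (-(2 * s) * g y - s ^ 2) ≤ ∫ y in c..b, g y ^ 2 :=
    intervalIntegral.integral_mono_on hc.2.le ((j1.const_mul _).sub intervalIntegrable_const) j2
      fun y _ => by nlinarith [sq_nonneg (g y + s)]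
  rw [intervalIntegral.integral_sub (i1.const_mul _) intervalIntegrable_const,
    intervalIntegral.integral_const_mul, i3, intervalIntegral.integral_const, smul_eq_mul] at hl
  rw [intervalIntegral.integral_sub (j1.const_mul _) intervalIntegrable_const,
    intervalIntegral.integral_const_mul, j3, intervalIntegral.integral_const, smul_eq_mul] at hr
  rw [← integral_Ioc_eq_integral_Ioo, ← intervalIntegral.integral_of_le (hc.1.trans hc.2).le,
    ← intervalIntegral.integral_add_adjacent_intervals i2 j2]
  have h1 := mul_le_mul_of_nonneg_left hsa hs
  have h2 := mul_le_mul_of_nonneg_left hsb hs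
  rw [ha] at hl
  rw [hb] at hr
  linarith

theorem isSupportDir_closure_iff {Ω : Set (ℝ × ℝ)} {ξ n : ℝ × ℝ} :
    IsSupportDir (closure Ω) ξ n ↔ IsSupportDir Ω ξ n := by
  refine ⟨fun h => ⟨h.1, fun q hq => h.2 q (subset_closure hq)⟩, fun h => ⟨h.1, fun q hq => ?_⟩⟩
  exact le_on_closure (f := fun q : ℝ × ℝ => n.1 * q.1 + n.2 * q.2)
    (g := fun _ => n.1 * ξ.1 + n.2 * ξ.2) h.2 (by fun_prop) (by fun_prop) hq

theorem IsSupportDir.notMem_interior {Ω : Set (ℝ × ℝ)} {ξ n : ℝ × ℝ} (h : IsSupportDir Ω ξ n) :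
    ξ ∉ interior Ω := by
  intro hξ
  have hcont : Continuous fun ε : ℝ => (ξ.1 + ε * n.1, ξ.2 + ε * n.2) := by fun_prop
  have hmem : ∀ᶠ ε in nhds (0 : ℝ), (ξ.1 + ε * n.1, ξ.2 + ε * n.2) ∈ Ω :=
    hcont.continuousAt.eventually_mem (by simpa using mem_interior_iff_mem_nhds.1 hξ)
  obtain ⟨ε, hε, hε0⟩ :=
    ((hmem.filter_mono nhdsWithin_le_nhds).and (self_mem_nhdsWithin (s := Ioi (0 : ℝ)))).exists
  have h1 := h.2 _ hε
  simp only at h1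
  have h2 : 0 < n.1 ^ 2 + n.2 ^ 2 := by
    by_contra! h3
    exact h.1 (Prod.ext (by simp; nlinarith [sq_nonneg n.1, sq_nonneg n.2])
      (by simp; nlinarith [sq_nonneg n.1, sq_nonneg n.2]))
  have h3 := mul_pos hε0 h2
  linarith

theorem IsUniqueSupportDir.isRegularPoint {Ω : Set (ℝ × ℝ)} {ξ n : ℝ × ℝ}
    (hξ : ξ ∈ closure Ω) (h : IsUniqueSupportDir (closure Ω) ξ n) : IsRegularPoint Ω ξ := by
  have hs := isSupportDir_closure_iff.1 h.1
  refine ⟨⟨hξ, hs.notMem_interior⟩, fun m m' hm hm' => ?_⟩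
  obtain ⟨t, rfl⟩ := h.2 m (isSupportDir_closure_iff.2 hm)
  obtain ⟨t', rfl⟩ := h.2 m' (isSupportDir_closure_iff.2 hm')
  have ht : t ≠ 0 := fun h0 => hm.1 (by simp [h0])
  exact ⟨t' / t, by rw [smul_smul, div_mul_cancel₀ _ ht]⟩

theorem sin_mul_sqrt_le_abs_snd {n : ℝ × ℝ} {β : ℝ}
    (h : |n.1| ≤ cos β * √(n.1 ^ 2 + n.2 ^ 2)) : sin β * √(n.1 ^ 2 + n.2 ^ 2) ≤ |n.2| := by
  have hsq : √(n.1 ^ 2 + n.2 ^ 2) ^ 2 = n.1 ^ 2 + n.2 ^ 2 := Real.sq_sqrt (by positivity)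
  refine abs_le_of_sq_le_sq' ?_ (abs_nonneg _) |>.2
  have h2 := pow_le_pow_left₀ (abs_nonneg _) h 2
  rw [sq_abs, mul_pow, hsq] at h2
  rw [sq_abs, mul_pow, hsq]
  linear_combination h2 + (n.1 ^ 2 + n.2 ^ 2) * sin_sq_add_cos_sq β

/-- A concave function which is continuous on the closure is concave along segments ending at
a point of the closure. -/
theorem ConcaveOn.le_of_mem_closure {Ω : Set (ℝ × ℝ)} {u : ℝ × ℝ → ℝ} (hu : ConcaveOn ℝ Ω u)
    (hcont : ContinuousOn u (closure Ω)) {p P : ℝ × ℝ} (hp : p ∈ Ω) (hP : P ∈ closure Ω) {a b : ℝ}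
    (ha : 0 ≤ a) (hb : 0 ≤ b) (hab : a + b = 1) :
    a * u p + b * u P ≤ u (a • p + b • P) := by
  refine le_on_closure (f := fun P => a * u p + b * u P) (g := fun P => u (a • p + b • P))
    (fun q hq => by simpa using hu.2 hp hq ha hb hab)
    (continuousOn_const.add (continuousOn_const.mul hcont))
    (hcont.comp (by fun_prop) fun q hq => ?_) hP
  exact hu.1.closure (subset_closure hp) hq ha hb hab

/-- A bounded planar open convex set meets a vertical line in an open segment whose endpoints lie
on the frontier. -/
theorem exists_verticalSlice_eq_Ioo {U : Set (ℝ × ℝ)} (hU : IsOpen U) (hconv : Convex ℝ U)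
    (hbdd : Bornology.IsBounded U) {x y : ℝ} (hxy : (x, y) ∈ U) :
    ∃ a b : ℝ, {z | (x, z) ∈ U} = Ioo a b ∧ (x, a) ∈ frontier U ∧ (x, b) ∈ frontier U := by
  set S := {z : ℝ | (x, z) ∈ U}
  have hne : S.Nonempty := ⟨y, hxy⟩
  have hSopen : IsOpen S := hU.preimage (by fun_prop : Continuous fun z : ℝ => (x, z))
  have hSconv : Convex ℝ S := by
    intro z hz w hw a b ha hb hab
    have := hconv hz hw ha hb hab
    simpa [S, Prod.smul_mk, ← add_mul, hab] using this
  have hSbdd : Bornology.IsBounded S := by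
    refine (hbdd.image_snd).subset fun z hz => ?_
    exact ⟨(x, z), hz, rfl⟩
  have hA := hSbdd.bddAbove
  have hB := hSbdd.bddBelow
  have hinf : sInf S ∉ S := fun hmem => by
    have : Ici (sInf S) ∈ nhds (sInf S) :=
      mem_of_superset (hSopen.mem_nhds hmem) fun z hz => csInf_le hB hz
    rw [← mem_interior_iff_mem_nhds, interior_Ici, mem_Ioi] at this
    exact lt_irrefl _ this
  have hsup : sSup S ∉ S := fun hmem => by
    have : Iic (sSup S) ∈ nhds (sSup S) :=
      mem_of_superset (hSopen.mem_nhds hmem) fun z hz => le_csSup hA hz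
    rw [← mem_interior_iff_mem_nhds, interior_Iic, mem_Iio] at this
    exact lt_irrefl _ this
  have hcl : ∀ z ∈ closure S, (x, z) ∈ closure U := fun z hz =>
    map_mem_closure (f := fun z : ℝ => (x, z)) (by fun_prop) hz fun z hz => hz
  refine ⟨sInf S, sSup S, Subset.antisymm (fun z hz => ⟨?_, ?_⟩)
    (IsConnected.Ioo_csInf_csSup_subset ⟨hne, hSconv.isPreconnected⟩ hB hA), ?_, ?_⟩
  · exact lt_of_le_of_ne (csInf_le hB hz) fun h0 => hinf (h0 ▸ hz)
  · exact lt_of_le_of_ne (le_csSup hA hz) fun h0 => hsup (h0 ▸ hz)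
  · rw [hU.frontier_eq]
    exact ⟨hcl _ (csInf_mem_closure hne hB), hinf⟩
  · rw [hU.frontier_eq]
    exact ⟨hcl _ (csSup_mem_closure hne hA), hsup⟩

theorem fst_lt_of_mem_interior {Ω : Set (ℝ × ℝ)} {r : ℝ} (hr : ∀ q ∈ Ω, q.1 ≤ r) {p : ℝ × ℝ}
    (hp : p ∈ interior Ω) : p.1 < r := by
  rw [← mem_Iio, ← interior_Iic, mem_interior_iff_mem_nhds]
  refine mem_of_superset (isOpenMap_fst.image_mem_nhds (mem_interior_iff_mem_nhds.1 hp)) ?_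
  rintro _ ⟨q, hq, rfl⟩
  exact hr q hq

theorem lt_fst_of_mem_interior {Ω : Set (ℝ × ℝ)} {r : ℝ} (hr : ∀ q ∈ Ω, r ≤ q.1) {p : ℝ × ℝ}
    (hp : p ∈ interior Ω) : r < p.1 := by
  rw [← mem_Ioi, ← interior_Ici, mem_interior_iff_mem_nhds]
  refine mem_of_superset (isOpenMap_fst.image_mem_nhds (mem_interior_iff_mem_nhds.1 hp)) ?_
  rintro _ ⟨q, hq, rfl⟩
  exact hr q hq

/-- On each vertical line meeting the interior of `Ω` there is a point at which `u` is large
compared with the vertical distance to the boundary. -/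
theorem exists_mem_slice_abs_sub_le {Ω : Set (ℝ × ℝ)} (hconv : Convex ℝ Ω)
    (hbdd : Bornology.IsBounded Ω) {u : ℝ × ℝ → ℝ} (hcont : ContinuousOn u (closure Ω))
    (hconc : ConcaveOn ℝ Ω u) (hzero : ∀ p ∈ frontier Ω, u p = 0) {p P : ℝ × ℝ} {C μ k σ : ℝ}
    (hp : p ∈ interior Ω) (hup : u p = 1) (hPcl : P ∈ frontier Ω) (hC : 0 ≤ C) (hμ : 0 ≤ μ)
    (hang : ∀ q ∈ Ω, |q.2 - P.2| ≤ C * |q.1 - P.1|)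
    (hsupp : ∀ ξ ∈ closure Ω, ∀ n, IsUniqueSupportDir (closure Ω) ξ n → |n.1| ≤ μ * |n.2| ∧
      n.1 * (ξ.1 - p.1) + n.2 * (ξ.2 - p.2) ≤ k * |n.2|)
    (hσ : σ * σ = 1) {x : ℝ} (hpx : σ * p.1 ≤ σ * x) (hxP : σ * x < σ * P.1) :
    ∃ c : ℝ, (x, c) ∈ interior Ω ∧ ∀ y, (x, y) ∈ closure Ω → |y - c| ≤ u (x, c) * k := by
  have hne : P.1 - p.1 ≠ 0 := fun h0 => by
    rw [sub_eq_zero.1 h0] at hxP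
    linarith
  have hpos : 0 < σ * (P.1 - p.1) := by linarith
  have hang' : ∀ q ∈ closure Ω, |q.2 - P.2| ≤ C * |q.1 - P.1| := fun q hq =>
    le_on_closure (f := fun q : ℝ × ℝ => |q.2 - P.2|) (g := fun q : ℝ × ℝ => C * |q.1 - P.1|)
      hang (by fun_prop) (by fun_prop) hq
  set t := (P.1 - x) / (P.1 - p.1) with ht
  have ht' : (x - p.1) / (P.1 - p.1) = 1 - t := by rw [ht]; field_simp; ring
  have hσ0 : σ ≠ 0 := fun h0 => by simp [h0] at hσ
  have htσ : t = (σ * (P.1 - x)) / (σ * (P.1 - p.1)) := by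
    rw [ht, mul_div_mul_left _ _ hσ0]
  have ht0 : 0 < t := by
    rw [htσ]
    exact div_pos (by linarith) hpos
  have ht1 : t ≤ 1 := by
    rw [htσ, div_le_one hpos]
    linarith
  have hcomb : t • p + (1 - t) • P = (x, t * p.2 + (1 - t) * P.2) := by
    refine Prod.ext ?_ ?_
    · simp only [Prod.fst_add, Prod.smul_fst, smul_eq_mul]
      rw [ht]
      field_simp
      ring
    · simp
  have hmem : (x, t * p.2 + (1 - t) * P.2) ∈ interior Ω := by
    rw [← hcomb]
    exact hconv.combo_interior_closure_mem_interior hp hPcl.1 ht0 (by linarith) (by ring)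
  have hut := hconc.le_of_mem_closure hcont (interior_subset hp) hPcl.1 ht0.le
    (show 0 ≤ 1 - t by linarith) (by ring)
  rw [hup, hzero P hPcl, hcomb] at hut
  have hchord : ∀ y, (x, y) ∈ closure Ω → |y - (t * p.2 + (1 - t) * P.2)| ≤ t * k := by
    intro y hy
    have := abs_sub_chord_le_of_isUniqueSupportDir hbdd.isCompact_closure hconv.closure
      (subset_closure (interior_subset hp)) hPcl.1 hC hμ hang' hsupp hσ (by linarith) hy hpx hxP.le
    simpa only [ht', ← ht] using this
  have hk : 0 ≤ k := by
    have := (abs_nonneg _).trans (hchord _ (subset_closure (interior_subset hmem)))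
    exact nonneg_of_mul_nonneg_right this ht0
  refine ⟨_, hmem, fun y hy => (hchord y hy).trans ?_⟩
  exact mul_le_mul_of_nonneg_right (by linarith) hk

theorem abs_uY_le {u : ℝ × ℝ → ℝ} {Ω : Set (ℝ × ℝ)} {M : ℝ} (hM0 : 0 ≤ M)
    (hM : ∀ p ∈ Ω, DifferentiableAt ℝ u p → ‖fderiv ℝ u p‖ ≤ M) {p : ℝ × ℝ} (hp : p ∈ Ω) :
    |uY u p| ≤ M := by
  by_cases hd : DifferentiableAt ℝ u p
  · refine ((fderiv ℝ u p).le_opNorm (0, 1)).trans ?_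
    simpa [Prod.norm_def] using hM p hp hd
  · simpa [uY, fderiv_zero_of_not_differentiableAt hd] using hM0

theorem hasDerivAt_uY {u : ℝ × ℝ → ℝ} {x y : ℝ} (h : DifferentiableAt ℝ u (x, y)) :
    HasDerivAt (fun z => u (x, z)) (uY u (x, y)) y :=
  h.hasFDerivAt.comp_hasDerivAt y ((hasDerivAt_const y x).prodMk (hasDerivAt_id y))

/-- The energy estimate on a single vertical slice of `Ω`. -/
theorem sq_mul_integral_slice_le {Ω : Set (ℝ × ℝ)} (hconv : Convex ℝ Ω)
    (hbdd : Bornology.IsBounded Ω) {u : ℝ × ℝ → ℝ} (hcont : ContinuousOn u (closure Ω))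
    (hconc : ConcaveOn ℝ Ω u) (hzero : ∀ p ∈ frontier Ω, u p = 0) {M : ℝ} (hM0 : 0 ≤ M)
    (hM : ∀ p ∈ Ω, DifferentiableAt ℝ u p → ‖fderiv ℝ u p‖ ≤ M) {s x : ℝ} (hs : 0 ≤ s)
    (hdiff : ∀ᵐ y, (x, y) ∈ interior Ω → DifferentiableAt ℝ u (x, y))
    (hc : (∃ y, (x, y) ∈ interior Ω) → ∃ c, (x, c) ∈ interior Ω ∧
      ∀ y, (x, y) ∈ closure Ω → s * |y - c| ≤ u (x, c)) :
    ∫ y, (interior Ω).indicator (fun _ => s ^ 2) (x, y) ≤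
      ∫ y, (interior Ω).indicator (fun p => uY u p ^ 2) (x, y) := by
  by_cases hne : ∃ y, (x, y) ∈ interior Ω
  swap
  · push Not at hne
    simp [hne]
  obtain ⟨c, hcmem, hcle⟩ := hc hne
  obtain ⟨a, b, hab, ha, hb⟩ := exists_verticalSlice_eq_Ioo isOpen_interior hconv.interior
    (hbdd.subset interior_subset) hcmem
  replace ha := frontier_interior_subset ha
  replace hb := frontier_interior_subset hb
  have hmem : ∀ y, (x, y) ∈ interior Ω ↔ y ∈ Ioo a b := fun y => by rw [← hab]; rfl
  have hind : ∀ f : ℝ × ℝ → ℝ, ∫ y, (interior Ω).indicator f (x, y) =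
      ∫ y in Ioo a b, f (x, y) := by
    intro f
    rw [← integral_indicator measurableSet_Ioo]
    refine integral_congr_ae (Eventually.of_forall fun y => ?_)
    by_cases hy : y ∈ Ioo a b
    · simp [indicator_of_mem, (hmem y).2 hy, hy]
    · simp [indicator_of_notMem, mt (hmem y).1 hy, hy]
  have hcab := (hmem c).1 hcmem
  have hacl : ∀ y ∈ Icc a b, (x, y) ∈ closure Ω := by
    intro y hy
    rw [← closure_Ioo (hcab.1.trans hcab.2).ne] at hy
    exact map_mem_closure (f := fun z : ℝ => (x, z)) (by fun_prop) hy
      fun z hz => interior_subset ((hmem z).2 hz)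
  rw [hind, hind, setIntegral_const, Measure.real, Real.volume_Ioo,
    ENNReal.toReal_ofReal (by linarith [hcab.1, hcab.2]), smul_eq_mul, mul_comm]
  have hbound : ∀ y ∈ Ioo a b, |uY u (x, y)| ≤ M := fun y hy =>
    abs_uY_le hM0 hM (interior_subset ((hmem y).2 hy))
  have hmeas : Measurable fun y => uY u (x, y) := (measurable_uY u).comp (by fun_prop)
  refine sq_mul_length_le_integral_sq_of_concaveOn (w := fun y => u (x, y))
    (g := fun y => uY u (x, y)) hcab hs ?_ ?_ (hzero _ ha) (hzero _ hb) ?_ ?_ ?_ ?_ ?_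
  · refine ⟨convex_Ioo _ _, fun y hy z hz α γ hα hγ hαγ => ?_⟩
    have := hconc.2 (interior_subset ((hmem y).2 hy)) (interior_subset ((hmem z).2 hz)) hα hγ hαγ
    simpa [Prod.smul_mk, ← add_mul, hαγ] using this
  · exact hcont.comp (by fun_prop) hacl
  · have := hcle a ha.1
    rwa [abs_sub_comm, abs_of_pos (by linarith [hcab.1])] at this
  · have := hcle b hb.1
    rwa [abs_of_pos (by linarith [hcab.2])] at this
  · refine Measure.integrableOn_of_bounded (M := M) (by simp) hmeas.aestronglyMeasurable ?_
    rw [ae_restrict_iff' measurableSet_Ioo]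
    exact Eventually.of_forall hbound
  · refine Measure.integrableOn_of_bounded (M := M ^ 2) (by simp)
      (hmeas.pow_const 2).aestronglyMeasurable ?_
    rw [ae_restrict_iff' measurableSet_Ioo]
    refine Eventually.of_forall fun y hy => ?_
    rw [Real.norm_eq_abs, abs_pow]
    exact pow_le_pow_left₀ (abs_nonneg _) (hbound y hy) 2
  · filter_upwards [hdiff] with y hy hyab using hasDerivAt_uY (hy ((hmem y).2 hyab))

theorem mul_abs_fst_le_of_isUniqueSupportDir {Ω : Set (ℝ × ℝ)} {β h : ℝ}
    (hβ : 0 < sin β) (hcos : 0 ≤ cos β) (hh : 0 ≤ h)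
    (hreg : ∀ ξ n : ℝ × ℝ, IsRegularPoint Ω ξ → IsSupportDir Ω ξ n →
      |n.1| ≤ cos β * √(n.1 ^ 2 + n.2 ^ 2))
    (hdist : ∀ q ∈ Ω, ∀ ξ n : ℝ × ℝ, ξ ∈ closure Ω → IsSupportDir Ω ξ n →
      (n.1 * ξ.1 + n.2 * ξ.2) - (n.1 * q.1 + n.2 * q.2) ≤ h * √(n.1 ^ 2 + n.2 ^ 2))
    {p : ℝ × ℝ} (hp : p ∈ Ω) {ξ : ℝ × ℝ} (hξ : ξ ∈ closure Ω) {n : ℝ × ℝ}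
    (hn : IsUniqueSupportDir (closure Ω) ξ n) :
    |n.1| ≤ cos β / sin β * |n.2| ∧
      n.1 * (ξ.1 - p.1) + n.2 * (ξ.2 - p.2) ≤ h / sin β * |n.2| := by
  have hs := isSupportDir_closure_iff.1 hn.1
  have h1 := hreg ξ n (hn.isRegularPoint hξ) hs
  have h2 := hdist p hp ξ n hξ hs
  have h3 : √(n.1 ^ 2 + n.2 ^ 2) ≤ |n.2| / sin β := by
    rw [le_div_iff₀ hβ, mul_comm]
    exact sin_mul_sqrt_le_abs_snd h1
  constructor
  · calc |n.1| ≤ cos β * (|n.2| / sin β) := h1.trans (mul_le_mul_of_nonneg_left h3 hcos)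
      _ = cos β / sin β * |n.2| := by ring
  · calc n.1 * (ξ.1 - p.1) + n.2 * (ξ.2 - p.2) ≤ h * (|n.2| / sin β) := by
          linarith [mul_le_mul_of_nonneg_left h3 hh]
      _ = h / sin β * |n.2| := by ring

/-- If both vertical support lines of `Ω` are angular, every support line at a regular
boundary point makes an angle at least `β` with the vertical, and `h` bounds the
distance from points of `Ω` to support lines, then every `u ∈ U_Ω` with `max_Ω u = 1`
satisfies `∫_Ω u_y² ≥ (sin²β/h²)|Ω|`. -/
theorem stmt14 (Ω : Set (ℝ × ℝ)) (hconv : Convex ℝ Ω) (hbdd : Bornology.IsBounded Ω)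
    (hint : (interior Ω).Nonempty)
    (hangL : AngularSupportAt Ω (leftX Ω)) (hangR : AngularSupportAt Ω (rightX Ω))
    (β : ℝ) (hβ : β ∈ Ioo 0 (π / 2))
    (hreg : ∀ ξ n : ℝ × ℝ, IsRegularPoint Ω ξ → IsSupportDir Ω ξ n →
      |n.1| ≤ Real.cos β * Real.sqrt (n.1 ^ 2 + n.2 ^ 2))
    (h : ℝ) (hh0 : 0 < h)
    (hdist : ∀ q ∈ Ω, ∀ ξ n : ℝ × ℝ, ξ ∈ closure Ω → IsSupportDir Ω ξ n →
      (n.1 * ξ.1 + n.2 * ξ.2) - (n.1 * q.1 + n.2 * q.2) ≤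
        h * Real.sqrt (n.1 ^ 2 + n.2 ^ 2))
    (u : ℝ × ℝ → ℝ) (hu : MemU Ω u)
    (hle : ∀ p ∈ Ω, u p ≤ 1) (hmax : ∃ p ∈ Ω, u p = 1) :
    (Real.sin β) ^ 2 / h ^ 2 * (volume Ω).toReal ≤ ∫ p in Ω, (uY u p) ^ 2 := by
  obtain ⟨hcont, hconc, hdiff, ⟨M, hM⟩, hzero⟩ := hu
  obtain ⟨p, hpΩ, hup⟩ := hmax
  have hsin : 0 < sin β := sin_pos_of_pos_of_lt_pi hβ.1 (by linarith [hβ.2, pi_pos])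
  have hcos : 0 < cos β := cos_pos_of_mem_Ioo ⟨by linarith [hβ.1, pi_pos], hβ.2⟩
  have hp : p ∈ interior Ω := by
    by_contra hp
    have := hzero p ⟨subset_closure hpΩ, hp⟩
    linarith
  have hsupp := fun ξ (hξ : ξ ∈ closure Ω) n hn =>
    mul_abs_fst_le_of_isUniqueSupportDir (n := n) hsin hcos.le hh0.le hreg hdist hpΩ hξ hn
  have hleft : ∀ q ∈ Ω, leftX Ω ≤ q.1 := fun q hq =>
    csInf_le hbdd.image_fst.bddBelow (mem_image_of_mem _ hq)
  have hright : ∀ q ∈ Ω, q.1 ≤ rightX Ω := fun q hq =>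
    le_csSup hbdd.image_fst.bddAbove (mem_image_of_mem _ hq)
  have hslice : ∀ x, (∃ y, (x, y) ∈ interior Ω) → ∃ c, (x, c) ∈ interior Ω ∧
      ∀ y, (x, y) ∈ closure Ω → sin β / h * |y - c| ≤ u (x, c) := by
    rintro x ⟨y₀, hy₀⟩
    have hk : ∃ c, (x, c) ∈ interior Ω ∧
        ∀ y, (x, y) ∈ closure Ω → |y - c| ≤ u (x, c) * (h / sin β) := by
      rcases le_total p.1 x with hpx | hpx
      · obtain ⟨P₂, hP, C, hC, hang⟩ := hangR
        exact exists_mem_slice_abs_sub_le hconv hbdd hcont hconc hzero hp hup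
          ⟨hP, fun h0 => lt_irrefl _ (fst_lt_of_mem_interior hright h0)⟩ hC.le
          (div_pos hcos hsin).le hang hsupp (σ := 1) (by norm_num) (by linarith)
          (by linarith [fst_lt_of_mem_interior hright hy₀])
      · obtain ⟨P₂, hP, C, hC, hang⟩ := hangL
        exact exists_mem_slice_abs_sub_le hconv hbdd hcont hconc hzero hp hup
          ⟨hP, fun h0 => lt_irrefl _ (lt_fst_of_mem_interior hleft h0)⟩ hC.le
          (div_pos hcos hsin).le hang hsupp (σ := -1) (by norm_num) (by linarith)
          (by linarith [lt_fst_of_mem_interior hleft hy₀])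
    obtain ⟨c, hc, hcle⟩ := hk
    refine ⟨c, hc, fun y hy => ?_⟩
    calc sin β / h * |y - c| ≤ sin β / h * (u (x, c) * (h / sin β)) :=
          mul_le_mul_of_nonneg_left (hcle y hy) (by positivity)
      _ = u (x, c) := by field_simp
  have hM' : ∀ p ∈ Ω, DifferentiableAt ℝ u p → ‖fderiv ℝ u p‖ ≤ max M 0 :=
    fun q hq hd => (hM q hq hd).trans (le_max_left _ _)
  have hdiff' : ∀ᵐ q : ℝ × ℝ, q ∈ interior Ω → DifferentiableAt ℝ u q := by
    rw [← ae_restrict_iff' isOpen_interior.measurableSet]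
    exact ae_restrict_of_ae_restrict_of_subset interior_subset hdiff
  have hae : (interior Ω : Set (ℝ × ℝ)) =ᵐ[volume] Ω :=
    interior_ae_eq_of_null_frontier (hconv.addHaar_frontier volume)
  have hfin : volume (interior Ω) ≠ ⊤ := (hbdd.subset interior_subset).measure_lt_top.ne
  have hint1 : Integrable ((interior Ω).indicator fun _ : ℝ × ℝ => (sin β / h) ^ 2)
      (volume.prod volume) :=
    (integrable_indicator_iff isOpen_interior.measurableSet).2 (integrableOn_const hfin)
  have hint2 : Integrable ((interior Ω).indicator fun q : ℝ × ℝ => uY u q ^ 2)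
      (volume.prod volume) := by
    rw [integrable_indicator_iff isOpen_interior.measurableSet]
    refine Measure.integrableOn_of_bounded (M := (max M 0) ^ 2) hfin
      ((measurable_uY u).pow_const 2).aestronglyMeasurable ?_
    rw [ae_restrict_iff' isOpen_interior.measurableSet]
    refine Eventually.of_forall fun q hq => ?_
    rw [Real.norm_eq_abs, abs_pow]
    exact pow_le_pow_left₀ (abs_nonneg _)
      (abs_uY_le (le_max_right _ _) hM' (interior_subset hq)) 2
  calc sin β ^ 2 / h ^ 2 * (volume Ω).toReal
      = ∫ q, (interior Ω).indicator (fun _ : ℝ × ℝ => (sin β / h) ^ 2) q := by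
        rw [integral_indicator isOpen_interior.measurableSet, setIntegral_const, Measure.real,
          measure_congr hae, smul_eq_mul, div_pow, mul_comm]
    _ = ∫ x, ∫ y, (interior Ω).indicator (fun _ : ℝ × ℝ => (sin β / h) ^ 2) (x, y) :=
        integral_prod _ hint1
    _ ≤ ∫ x, ∫ y, (interior Ω).indicator (fun q => uY u q ^ 2) (x, y) := by
        refine integral_mono_ae hint1.integral_prod_left hint2.integral_prod_left ?_
        filter_upwards [Measure.ae_ae_of_ae_prod hdiff'] with x hx
        exact sq_mul_integral_slice_le hconv hbdd hcont hconc hzero (le_max_right M 0) hM'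
          (by positivity) hx (hslice x)
    _ = ∫ q, (interior Ω).indicator (fun q => uY u q ^ 2) q := (integral_prod _ hint2).symm
    _ = ∫ q in Ω, uY u q ^ 2 := by
        rw [integral_indicator isOpen_interior.measurableSet, setIntegral_congr_set hae]
end

section
/- Let Ω ⊂ ℝ² be a convex bounded set with nonempty interior, let ξ₀ be an interior point of Ω, and let ũ : Ω → ℝ be the smallest continuous concave function on Ω with ũ = 0 on ∂Ω and ũ(ξ₀) = 1 (the cone function whose graph is the union of the segments joining (ξ₀,1) to the points of ∂Ω × {0}). Let h be the maximum distance between a point of Ω and a line of support to Ω, and suppose β ∈ (0, π/2) is such that the support line at every regular point of ∂Ω forms an angle at least β with the vertical direction. Then at every point where ũ is differentiable one has |∇ũ| ≥ 1/h, and ∫_Ω ũ_y² dx dy ≥ (sin² β / h²) · |Ω|. -/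
open MeasureTheory Real Set Filter Asymptotics

/-- A one-sided lower bound on the increments along a segment bounds the derivative below. -/
lemma HasFDerivAt.le_apply_of_forall_increment {E : Type*} [NormedAddCommGroup E]
    [NormedSpace ℝ E] {f : E → ℝ} {L : E →L[ℝ] ℝ} {p d : E} {a : ℝ} (hf : HasFDerivAt f L p)
    (ha : ∀ t ∈ Ioo (0 : ℝ) 1, t * a ≤ f (p + t • d) - f p) : a ≤ L d := by
  refine ge_of_tendsto (hf.hasLineDerivAt d).tendsto_slope_zero_right ?_
  filter_upwards [Ioo_mem_nhdsGT (zero_lt_one' ℝ)] with t ht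
  have := ha t ht
  rw [smul_eq_mul, ← div_eq_inv_mul, le_div_iff₀ ht.1]
  linarith

/-- The graph of a concave function lies below its tangent planes. -/
lemma ConcaveOn.sub_le_hasFDerivAt {E : Type*} [NormedAddCommGroup E]
    [NormedSpace ℝ E] {s : Set E} {f : E → ℝ} {L : E →L[ℝ] ℝ} {p q : E} (hc : ConcaveOn ℝ s f)
    (hf : HasFDerivAt f L p) (hp : p ∈ s) (hq : q ∈ s) : f q - f p ≤ L (q - p) := by
  refine hf.le_apply_of_forall_increment fun t ht => ?_
  have := hc.2 hp hq (sub_nonneg.2 ht.2.le) ht.1.le (by ring)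
  rw [show p + t • (q - p) = (1 - t) • p + t • q by module]
  simp only [smul_eq_mul] at this
  linarith

/-- The function whose graph is the cone with apex `(ξ₀, 1)` over `∂Ω × {0}`. -/
noncomputable def coneFn {E : Type*} [AddCommGroup E] [Module ℝ E] (Ω : Set E) (ξ₀ p : E) : ℝ :=
  1 - gauge ((fun d => ξ₀ + d) ⁻¹' Ω) (p - ξ₀)

lemma preimage_add_left_mem_nhds_zero {E : Type*} [NormedAddCommGroup E] {Ω : Set E} {ξ₀ : E}
    (hξ₀ : ξ₀ ∈ interior Ω) :
    (fun d => ξ₀ + d) ⁻¹' Ω ∈ nhds (0 : E) := by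
  refine (continuous_const.add continuous_id).continuousAt.preimage_mem_nhds ?_
  simpa using mem_interior_iff_mem_nhds.1 hξ₀

section Cone

variable {E : Type*} [NormedAddCommGroup E] [NormedSpace ℝ E] {Ω : Set E} {ξ₀ : E}

@[simp]
lemma coneFn_apex : coneFn Ω ξ₀ ξ₀ = 1 := by simp [coneFn]

lemma coneFn_add_smul (d : E) {t : ℝ} (ht : 0 ≤ t) :
    coneFn Ω ξ₀ (ξ₀ + t • d) = 1 - t * (1 - coneFn Ω ξ₀ (ξ₀ + d)) := by
  simp [coneFn, gauge_smul_of_nonneg ht]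

lemma coneFn_le_one (p : E) : coneFn Ω ξ₀ p ≤ 1 := by
  simp [coneFn, gauge_nonneg]

lemma coneFn_eq_zero_iff (hconv : Convex ℝ Ω) (hξ₀ : ξ₀ ∈ interior Ω) {p : E} :
    coneFn Ω ξ₀ p = 0 ↔ p ∈ frontier Ω := by
  have h := gauge_eq_one_iff_mem_frontier (x := p - ξ₀) (hconv.translate_preimage_right ξ₀)
    (preimage_add_left_mem_nhds_zero hξ₀)
  have h2 := (Homeomorph.addLeft ξ₀).preimage_frontier Ω
  simp only [Homeomorph.coe_addLeft] at h2
  rw [← h2, mem_preimage, add_sub_cancel] at h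
  rw [← h, coneFn, sub_eq_zero, eq_comm]

lemma coneFn_pos_iff (hconv : Convex ℝ Ω) (hξ₀ : ξ₀ ∈ interior Ω) {p : E} :
    0 < coneFn Ω ξ₀ p ↔ p ∈ interior Ω := by
  have h := gauge_lt_one_iff_mem_interior (x := p - ξ₀) (hconv.translate_preimage_right ξ₀)
    (preimage_add_left_mem_nhds_zero hξ₀)
  have h2 := (Homeomorph.addLeft ξ₀).preimage_interior Ω
  simp only [Homeomorph.coe_addLeft] at h2
  rw [← h2, mem_preimage, add_sub_cancel] at h
  rw [← h, coneFn, sub_pos]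

lemma coneFn_lt_one (hbdd : Bornology.IsBounded Ω) (hξ₀ : ξ₀ ∈ interior Ω) {p : E}
    (hp : p ≠ ξ₀) : coneFn Ω ξ₀ p < 1 := by
  have hb : Bornology.IsVonNBounded ℝ ((fun d => ξ₀ + d) ⁻¹' Ω) := by
    rw [NormedSpace.isVonNBounded_iff]
    exact (AntilipschitzWith.isBounded_preimage
      (isometry_add_left ξ₀).antilipschitz hbdd)
  have := (gauge_pos (absorbent_nhds_zero (preimage_add_left_mem_nhds_zero hξ₀)) hb).2
    (sub_ne_zero.2 hp)
  rw [coneFn]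
  linarith

lemma concaveOn_coneFn (hconv : Convex ℝ Ω) (hξ₀ : ξ₀ ∈ interior Ω) :
    ConcaveOn ℝ univ (coneFn Ω ξ₀) := by
  refine ⟨convex_univ, fun x _ y _ a b ha hb hab => ?_⟩
  have h := gauge_add_le (hconv.translate_preimage_right ξ₀)
    (absorbent_nhds_zero (preimage_add_left_mem_nhds_zero hξ₀)) (a • (x - ξ₀)) (b • (y - ξ₀))
  rw [gauge_smul_of_nonneg ha, gauge_smul_of_nonneg hb,
    show a • (x - ξ₀) + b • (y - ξ₀) = a • x + b • y - (a + b) • ξ₀ by module, hab,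
    one_smul] at h
  simp only [coneFn, smul_eq_mul] at h ⊢
  linarith

lemma exists_lipschitzWith_coneFn (hconv : Convex ℝ Ω) (hξ₀ : ξ₀ ∈ interior Ω) :
    ∃ K, LipschitzWith K (coneFn Ω ξ₀) := by
  obtain ⟨K, hK⟩ := (hconv.translate_preimage_right ξ₀).lipschitz_gauge
    (preimage_add_left_mem_nhds_zero hξ₀)
  refine ⟨K, LipschitzWith.of_dist_le_mul fun x y => ?_⟩
  have := hK.dist_le_mul (x - ξ₀) (y - ξ₀)
  rw [dist_sub_right, ← dist_sub_left (1 : ℝ)] at this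
  exact this

/-- A point of `Ω` other than the apex is on the segment from the apex to a boundary point. -/
lemma exists_frontier_eq_add_smul (hconv : Convex ℝ Ω) (hξ₀ : ξ₀ ∈ interior Ω) {p : E}
    (hp : coneFn Ω ξ₀ p < 1) :
    ∃ ξ ∈ frontier Ω, p = ξ₀ + (1 - coneFn Ω ξ₀ p) • (ξ - ξ₀) := by
  set s := 1 - coneFn Ω ξ₀ p with hs
  have hs0 : 0 < s := by linarith
  refine ⟨ξ₀ + s⁻¹ • (p - ξ₀), ?_, ?_⟩
  · rw [← coneFn_eq_zero_iff hconv hξ₀, coneFn_add_smul _ (inv_nonneg.2 hs0.le),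
      add_sub_cancel, ← hs, inv_mul_cancel₀ hs0.ne', sub_self]
  · rw [add_sub_cancel_left, smul_inv_smul₀ hs0.ne', add_sub_cancel]

lemma coneFn_nonneg (hconv : Convex ℝ Ω) (hξ₀ : ξ₀ ∈ interior Ω) {p : E} (hp : p ∈ closure Ω) :
    0 ≤ coneFn Ω ξ₀ p := by
  by_cases hi : p ∈ interior Ω
  · exact ((coneFn_pos_iff hconv hξ₀).2 hi).le
  · exact ((coneFn_eq_zero_iff hconv hξ₀).2 ⟨hp, hi⟩).ge

/-- The cone function lies below every concave function with the same apex and boundary values. -/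
lemma coneFn_le_of_concaveOn (hconv : Convex ℝ Ω) (hbdd : Bornology.IsBounded Ω)
    (hξ₀ : ξ₀ ∈ interior Ω) {v : E → ℝ} (hcont : ContinuousOn v (closure Ω)) (hconc : ConcaveOn ℝ Ω v)
    (hbdry : ∀ p ∈ frontier Ω, v p = 0) (hv1 : v ξ₀ = 1) {p : E} (hp : p ∈ Ω) :
    coneFn Ω ξ₀ p ≤ v p := by
  rcases eq_or_ne p ξ₀ with rfl | hne
  · rw [coneFn_apex, hv1]
  have h1 := coneFn_lt_one hbdd hξ₀ hne
  rcases (coneFn_nonneg hconv hξ₀ (subset_closure hp)).eq_or_lt with h0 | h0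
  · rw [← h0, hbdry p ((coneFn_eq_zero_iff hconv hξ₀).1 h0.symm)]
  obtain ⟨ξ, hξ, hpξ⟩ := exists_frontier_eq_add_smul hconv hξ₀ h1
  set s := 1 - coneFn Ω ξ₀ p with hs
  have hs0 : 0 < s := by linarith
  have hs1 : s < 1 := by linarith
  have hmem : ∀ t ∈ Ioo s 1, ξ₀ + t • (ξ - ξ₀) ∈ Ω := fun t ht => interior_subset <| by
    have := hconv.combo_interior_closure_mem_interior hξ₀ (frontier_subset_closure hξ)
      (sub_pos.2 ht.2) (hs0.trans ht.1).le (by ring)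
    rwa [show ξ₀ + t • (ξ - ξ₀) = (1 - t) • ξ₀ + t • ξ by module]
  have hT : Tendsto (fun t : ℝ => ξ₀ + t • (ξ - ξ₀)) (nhdsWithin 1 (Iio 1))
      (nhdsWithin ξ (closure Ω)) := by
    refine tendsto_nhdsWithin_iff.2 ⟨?_, ?_⟩
    · have : Continuous fun t : ℝ => ξ₀ + t • (ξ - ξ₀) := by fun_prop
      simpa using (this.tendsto 1).mono_left nhdsWithin_le_nhds
    · filter_upwards [Ioo_mem_nhdsLT hs1] with t ht using subset_closure (hmem t ht)
  have hv : Tendsto (fun t : ℝ => (1 - s / t) * 1 + s / t * v (ξ₀ + t • (ξ - ξ₀)))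
      (nhdsWithin 1 (Iio 1)) (nhds ((1 - s / 1) * 1 + s / 1 * v ξ)) := by
    have hid : Tendsto (fun t : ℝ => s / t) (nhdsWithin 1 (Iio 1)) (nhds (s / 1)) :=
      tendsto_const_nhds.div (tendsto_nhdsWithin_of_tendsto_nhds tendsto_id) one_ne_zero
    exact ((tendsto_const_nhds.sub hid).mul tendsto_const_nhds).add
      (hid.mul ((hcont ξ (frontier_subset_closure hξ)).tendsto.comp hT))
  rw [hbdry ξ hξ] at hv
  have hle := le_of_tendsto hv (b := v p) <| by
    filter_upwards [Ioo_mem_nhdsLT hs1] with t ht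
    have ht0 : 0 < t := hs0.trans ht.1
    have := hconc.2 (interior_subset hξ₀) (hmem t ht) 
      (sub_nonneg.2 ((div_le_one ht0).2 ht.1.le)) (div_pos hs0 ht0).le (by ring)
    rw [show (1 - s / t) • ξ₀ + (s / t) • (ξ₀ + t • (ξ - ξ₀)) = p by
      rw [hpξ, smul_add, smul_smul, div_mul_cancel₀ _ ht0.ne']; module, hv1] at this
    simpa using this
  linarith

/-- A functional supporting `Ω` at `ξ` gives an affine majorant of the cone. -/
lemma mul_one_sub_coneFn_ge (hξ₀ : ξ₀ ∈ interior Ω) {f : E →L[ℝ] ℝ} {ξ : E}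
    (hf : ∀ q ∈ Ω, f q ≤ f ξ) (q : E) :
    f (q - ξ₀) ≤ f (ξ - ξ₀) * (1 - coneFn Ω ξ₀ q) := by
  have hc : 0 ≤ f (ξ - ξ₀) := by
    rw [map_sub, sub_nonneg]; exact hf _ (interior_subset hξ₀)
  have key : ∀ r, gauge ((fun d => ξ₀ + d) ⁻¹' Ω) (q - ξ₀) < r →
      f (q - ξ₀) ≤ f (ξ - ξ₀) * r := fun r hr => by
    obtain ⟨b, hb0, hbr, x, hx, hxq⟩ := exists_lt_of_gauge_lt
      (absorbent_nhds_zero (preimage_add_left_mem_nhds_zero hξ₀)) hr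
    have hfx : f x ≤ f (ξ - ξ₀) := by
      have := hf _ hx
      rw [map_add] at this
      rw [map_sub]
      linarith
    rw [← hxq, map_smul, smul_eq_mul]
    nlinarith
  rw [coneFn, sub_sub_cancel]
  refine ge_of_tendsto (f := fun r => f (ξ - ξ₀) * r)
    (x := nhdsWithin (gauge ((fun d => ξ₀ + d) ⁻¹' Ω) (q - ξ₀)) (Ioi (gauge ((fun d => ξ₀ + d) ⁻¹' Ω) (q - ξ₀))))
    (tendsto_nhdsWithin_of_tendsto_nhds (tendsto_const_nhds.mul tendsto_id)) ?_
  filter_upwards [self_mem_nhdsWithin] with r hr using key r hr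

/-- The cone function is not differentiable at its apex. -/
lemma not_differentiableAt_coneFn_apex [Nontrivial E] (hbdd : Bornology.IsBounded Ω)
    (hξ₀ : ξ₀ ∈ interior Ω) : ¬ DifferentiableAt ℝ (coneFn Ω ξ₀) ξ₀ := by
  intro hd
  obtain ⟨d, hd0⟩ := exists_ne (0 : E)
  have key : ∀ e : E, e ≠ 0 → fderiv ℝ (coneFn Ω ξ₀) ξ₀ e < 0 := fun e he => by
    have hlt : coneFn Ω ξ₀ (ξ₀ + e) < 1 := coneFn_lt_one hbdd hξ₀ (by simpa using he)
    have := hd.hasFDerivAt.neg.le_apply_of_forall_increment (d := e)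
      (a := 1 - coneFn Ω ξ₀ (ξ₀ + e)) fun t ht => by
        simp [coneFn_add_smul e ht.1.le]
    rw [neg_apply] at this
    linarith
  have h1 := key d hd0
  have h2 := key (-d) (neg_ne_zero.2 hd0)
  rw [map_neg] at h2
  linarith

/-- At a point where a function agreeing with the cone on `Ω` is differentiable, its derivative
defines a support line at a boundary point lying on the ray from the apex. -/
lemma exists_support_of_hasFDerivAt (hconv : Convex ℝ Ω)
    (hξ₀ : ξ₀ ∈ interior Ω) {v : E → ℝ} (hv : ∀ q ∈ Ω, v q = coneFn Ω ξ₀ q) {p : E} (hp : p ∈ Ω)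
    (hp1 : coneFn Ω ξ₀ p < 1) {L : E →L[ℝ] ℝ} (hL : HasFDerivAt v L p) :
    ∃ ξ ∈ frontier Ω, p = ξ₀ + (1 - coneFn Ω ξ₀ p) • (ξ - ξ₀) ∧ 1 ≤ L (ξ₀ - ξ) ∧
      ∀ q ∈ Ω, L ξ ≤ L q := by
  obtain ⟨ξ, hξ, hpξ⟩ := exists_frontier_eq_add_smul hconv hξ₀ hp1
  have hconc : ConcaveOn ℝ Ω v :=
    ((concaveOn_coneFn hconv hξ₀).subset (subset_univ _) hconv).congr fun q hq => (hv q hq).symm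
  have hT : ∀ q ∈ Ω, coneFn Ω ξ₀ q - coneFn Ω ξ₀ p ≤ L q - L p := fun q hq => by
    rw [← hv q hq, ← hv p hp, ← map_sub]
    exact hconc.sub_le_hasFDerivAt hL hp hq
  have h0 := hT ξ₀ (interior_subset hξ₀)
  have hLp : L p = L ξ₀ + (1 - coneFn Ω ξ₀ p) * (L ξ - L ξ₀) := by
    conv_lhs => rw [hpξ]
    simp
  have hn := coneFn_nonneg hconv hξ₀ (subset_closure hp)
  rw [coneFn_apex] at h0
  have h1 : 1 ≤ L ξ₀ - L ξ := by nlinarith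
  refine ⟨ξ, hξ, hpξ, by rwa [map_sub], fun q hq => ?_⟩
  have hq0 := coneFn_nonneg hconv hξ₀ (subset_closure hq)
  have hqT := hT q hq
  nlinarith

/-- If the cone function is differentiable at a point of the segment from the apex to `ξ`, then
all supporting functionals at `ξ` are multiples of its derivative. -/
lemma eq_smul_fderiv_of_support (hξ₀ : ξ₀ ∈ interior Ω) {p ξ : E}
    (hpξ : p = ξ₀ + (1 - coneFn Ω ξ₀ p) • (ξ - ξ₀)) {L : E →L[ℝ] ℝ}
    (hL : HasFDerivAt (coneFn Ω ξ₀) L p) {f : E →L[ℝ] ℝ} (hf : ∀ q ∈ Ω, f q ≤ f ξ) :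
    f = (-f (ξ - ξ₀)) • L := by
  have hmax : IsLocalMax (fun q => f q + f (ξ - ξ₀) * coneFn Ω ξ₀ q) p := by
    refine Filter.Eventually.of_forall fun q => ?_
    have h1 := mul_one_sub_coneFn_ge hξ₀ hf q
    have h2 : f p = f ξ₀ + (1 - coneFn Ω ξ₀ p) * f (ξ - ξ₀) := by
      conv_lhs => rw [hpξ]
      rw [map_add, map_smul, smul_eq_mul]
    rw [map_sub] at h1
    simp only
    linarith
  have := hmax.hasFDerivAt_eq_zero (f.hasFDerivAt.add (hL.const_mul (f (ξ - ξ₀))))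
  exact (eq_neg_of_add_eq_zero_left this).trans (neg_smul _ L).symm

end Cone

lemma fderiv_apply_eq_uX_uY (u : ℝ × ℝ → ℝ) (p d : ℝ × ℝ) :
    fderiv ℝ u p d = uX u p * d.1 + uY u p * d.2 := by
  have : d = d.1 • ((1 : ℝ), (0 : ℝ)) + d.2 • ((0 : ℝ), (1 : ℝ)) := by ext <;> simp
  conv_lhs => rw [this]
  rw [map_add, map_smul, map_smul, uX, uY, smul_eq_mul, smul_eq_mul]
  ring

/-- The opposite of the gradient of the cone function is normal to a support line at the
corresponding boundary point, and its length is controlled by the distance to that line. -/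
lemma exists_isSupportDir_neg_gradient {Ω : Set (ℝ × ℝ)} (hconv : Convex ℝ Ω) {ξ₀ : ℝ × ℝ}
    (hξ₀ : ξ₀ ∈ interior Ω) {v : ℝ × ℝ → ℝ} (hv : ∀ q ∈ Ω, v q = coneFn Ω ξ₀ q) {p : ℝ × ℝ}
    (hp : p ∈ Ω) (hp1 : coneFn Ω ξ₀ p < 1) (hd : DifferentiableAt ℝ v p) :
    ∃ ξ ∈ frontier Ω, p = ξ₀ + (1 - coneFn Ω ξ₀ p) • (ξ - ξ₀) ∧
      IsSupportDir Ω ξ (-uX v p, -uY v p) ∧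
      1 ≤ -uX v p * ξ.1 + -uY v p * ξ.2 - (-uX v p * ξ₀.1 + -uY v p * ξ₀.2) := by
  obtain ⟨ξ, hξ, hpξ, h1, hs⟩ := exists_support_of_hasFDerivAt hconv hξ₀ hv hp hp1 hd.hasFDerivAt
  rw [map_sub, fderiv_apply_eq_uX_uY, fderiv_apply_eq_uX_uY] at h1
  refine ⟨ξ, hξ, hpξ, ⟨fun h0 => ?_, fun q hq => ?_⟩, by linarith⟩
  · obtain ⟨hx, hy⟩ := Prod.mk_eq_zero.1 h0
    rw [neg_eq_zero.1 hx, neg_eq_zero.1 hy] at h1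
    norm_num at h1
  · have := hs q hq
    rw [fderiv_apply_eq_uX_uY, fderiv_apply_eq_uX_uY] at this
    dsimp only
    linarith

/-- Boundary points on rays through differentiability points of the cone function are regular. -/
lemma isRegularPoint_of_differentiableAt_coneFn {Ω : Set (ℝ × ℝ)} {ξ₀ : ℝ × ℝ}
    (hξ₀ : ξ₀ ∈ interior Ω) {p ξ : ℝ × ℝ} (hξ : ξ ∈ frontier Ω)
    (hpξ : p = ξ₀ + (1 - coneFn Ω ξ₀ p) • (ξ - ξ₀))
    (hd : DifferentiableAt ℝ (coneFn Ω ξ₀) p) : IsRegularPoint Ω ξ := by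
  set L := fderiv ℝ (coneFn Ω ξ₀) p
  have key : ∀ n, IsSupportDir Ω ξ n → ∃ c : ℝ, n = c • (L (1, 0), L (0, 1)) := fun n hn => by
    let f := n.1 • ContinuousLinearMap.fst ℝ ℝ ℝ + n.2 • ContinuousLinearMap.snd ℝ ℝ ℝ
    have hf : ∀ d, f d = n.1 * d.1 + n.2 * d.2 := fun d => by simp [f]
    have := eq_smul_fderiv_of_support hξ₀ hpξ hd.hasFDerivAt (f := f)
      (fun q hq => by simpa only [hf] using hn.2 q hq)
    refine ⟨-f (ξ - ξ₀), Prod.ext ?_ ?_⟩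
    · have := DFunLike.congr_fun this ((1 : ℝ), (0 : ℝ))
      rw [hf] at this
      simpa using this
    · have := DFunLike.congr_fun this ((0 : ℝ), (1 : ℝ))
      rw [hf] at this
      simpa using this
  refine ⟨hξ, fun n m hn hm => ?_⟩
  obtain ⟨a, ha⟩ := key n hn
  obtain ⟨b, hb⟩ := key m hm
  have ha0 : a ≠ 0 := by
    rintro rfl
    exact hn.1 (by rw [ha, zero_smul])
  exact ⟨b / a, by rw [hb, ha, smul_smul, div_mul_cancel₀ _ ha0]⟩

/-- For the cone function `ũ` (the smallest continuous concave function on `Ω` vanishing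
on `∂Ω` with `ũ(ξ₀) = 1`), if `h` bounds the distances from points of `Ω` to support
lines and every support line at a regular boundary point makes an angle at least `β`
with the vertical, then `|∇ũ| ≥ 1/h` at every point of differentiability and
`∫_Ω ũ_y² ≥ (sin²β/h²)|Ω|`. -/
theorem stmt19 (Ω : Set (ℝ × ℝ)) (hconv : Convex ℝ Ω) (hbdd : Bornology.IsBounded Ω)
    (hint : (interior Ω).Nonempty) (ξ₀ : ℝ × ℝ) (hξ₀ : ξ₀ ∈ interior Ω)
    (v : ℝ × ℝ → ℝ) (hcont : ContinuousOn v (closure Ω)) (hconc : ConcaveOn ℝ Ω v)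
    (hbdry : ∀ p ∈ frontier Ω, v p = 0) (hv1 : v ξ₀ = 1)
    (hmin : ∀ w : ℝ × ℝ → ℝ, ContinuousOn w (closure Ω) → ConcaveOn ℝ Ω w →
      (∀ p ∈ frontier Ω, w p = 0) → w ξ₀ = 1 → ∀ p ∈ Ω, v p ≤ w p)
    (h : ℝ) (hh0 : 0 < h)
    (hdist : ∀ q ∈ Ω, ∀ ξ n : ℝ × ℝ, ξ ∈ closure Ω → IsSupportDir Ω ξ n →
      (n.1 * ξ.1 + n.2 * ξ.2) - (n.1 * q.1 + n.2 * q.2) ≤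
        h * Real.sqrt (n.1 ^ 2 + n.2 ^ 2))
    (β : ℝ) (hβ : β ∈ Ioo 0 (π / 2))
    (hreg : ∀ ξ n : ℝ × ℝ, IsRegularPoint Ω ξ → IsSupportDir Ω ξ n →
      |n.1| ≤ Real.cos β * Real.sqrt (n.1 ^ 2 + n.2 ^ 2)) :
    (∀ p ∈ Ω, DifferentiableAt ℝ v p →
      1 / h ≤ Real.sqrt ((uX v p) ^ 2 + (uY v p) ^ 2)) ∧
    (Real.sin β) ^ 2 / h ^ 2 * (volume Ω).toReal ≤ ∫ p in Ω, (uY v p) ^ 2 := by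
  obtain ⟨K, hK⟩ := exists_lipschitzWith_coneFn hconv hξ₀
  have hv : ∀ q ∈ Ω, v q = coneFn Ω ξ₀ q := fun q hq => le_antisymm
    (hmin _ hK.continuous.continuousOn
      ((concaveOn_coneFn hconv hξ₀).subset (subset_univ _) hconv)
      (fun p hp => (coneFn_eq_zero_iff hconv hξ₀).2 hp) coneFn_apex q hq)
    (coneFn_le_of_concaveOn hconv hbdd hξ₀ hcont hconc hbdry hv1 hq)
  have hev : ∀ p ∈ interior Ω, v =ᶠ[nhds p] coneFn Ω ξ₀ := fun p hp => by
    filter_upwards [mem_interior_iff_mem_nhds.1 hp] with q hq using hv q hq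
  have hlt : ∀ p ∈ Ω, DifferentiableAt ℝ v p → coneFn Ω ξ₀ p < 1 := fun p _ hd => by
    refine coneFn_lt_one hbdd hξ₀ ?_
    rintro rfl
    exact not_differentiableAt_coneFn_apex hbdd hξ₀ ((hev p hξ₀).differentiableAt_iff.1 hd)
  have hgrad : ∀ p ∈ Ω, DifferentiableAt ℝ v p →
      1 / h ≤ Real.sqrt ((uX v p) ^ 2 + (uY v p) ^ 2) := fun p hp hd => by
    obtain ⟨ξ, hξ, -, hn, h1⟩ :=
      exists_isSupportDir_neg_gradient hconv hξ₀ hv hp (hlt p hp hd) hd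
    have := hdist ξ₀ (interior_subset hξ₀) ξ _ (frontier_subset_closure hξ) hn
    simp only [neg_sq] at this
    rw [div_le_iff₀ hh0]
    linarith
  refine ⟨hgrad, ?_⟩
  have hpt : ∀ p ∈ interior Ω, DifferentiableAt ℝ v p →
      (Real.sin β) ^ 2 / h ^ 2 ≤ (uY v p) ^ 2 := fun p hp hd => by
    have hpΩ := interior_subset hp
    obtain ⟨ξ, hξ, hpξ, hn, -⟩ :=
      exists_isSupportDir_neg_gradient hconv hξ₀ hv hpΩ (hlt p hpΩ hd) hd
    have hle := hreg ξ _ (isRegularPoint_of_differentiableAt_coneFn hξ₀ hξ hpξ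
      ((hev p hp).differentiableAt_iff.1 hd)) hn
    simp only [neg_sq, abs_neg] at hle
    have hg := hgrad p hpΩ hd
    have hnn : 0 ≤ (uX v p) ^ 2 + (uY v p) ^ 2 := by positivity
    have hx := pow_le_pow_left₀ (abs_nonneg _) hle 2
    have hg2 := pow_le_pow_left₀ (one_div_pos.2 hh0).le hg 2
    rw [sq_abs, mul_pow, Real.sq_sqrt hnn, Real.cos_sq'] at hx
    rw [Real.sq_sqrt hnn, div_pow, one_pow] at hg2
    have := mul_le_mul_of_nonneg_left hg2 (sq_nonneg (Real.sin β))
    rw [mul_one_div] at this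
    linarith
  have hΩ := hconv.nullMeasurableSet (volume : Measure (ℝ × ℝ))
  have hfin : volume Ω ≠ ⊤ := hbdd.measure_lt_top.ne
  have hae : ∀ᵐ p ∂(volume.restrict Ω), p ∈ interior Ω ∧ DifferentiableAt ℝ v p := by
    rw [ae_restrict_iff'₀ hΩ]
    have hfr := measure_eq_zero_iff_ae_notMem.1 (hconv.addHaar_frontier volume)
    filter_upwards [hK.ae_differentiableAt (μ := volume), hfr] with p hd hf hp
    have hpi : p ∈ interior Ω := by
      by_contra hni
      exact hf ⟨subset_closure hp, hni⟩
    exact ⟨hpi, (hev p hpi).differentiableAt_iff.2 hd⟩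
  have hint2 : IntegrableOn (fun p => (uY v p) ^ 2) Ω := by
    refine Measure.integrableOn_of_bounded (M := (K : ℝ) ^ 2) hfin
      ((measurable_fderiv_apply_const ℝ v (0, 1)).pow_const 2).aestronglyMeasurable ?_
    filter_upwards [hae] with p hp
    rw [norm_pow, uY, (hev p hp.1).fderiv_eq]
    refine pow_le_pow_left₀ (norm_nonneg _) ?_ 2
    refine ((fderiv ℝ (coneFn Ω ξ₀) p).le_of_opNorm_le (norm_fderiv_le_of_lipschitz ℝ hK)
      _).trans ?_
    simp [Prod.norm_def]
  calc (Real.sin β) ^ 2 / h ^ 2 * (volume Ω).toReal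
      = ∫ _ in Ω, (Real.sin β) ^ 2 / h ^ 2 := by
        rw [setIntegral_const, smul_eq_mul, mul_comm, Measure.real]
    _ ≤ ∫ p in Ω, (uY v p) ^ 2 := by
        refine integral_mono_ae (integrableOn_const hfin) hint2 ?_
        filter_upwards [hae] with p hp using hpt p hp.1 hp.2
end
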